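/- arXiv:2405.15416 — 2 statements merged into one kernel-verified Lean document; each statement's English description precedes it below -/
import Mathlib

section
/- A matching covered graph G is cycle-extendable if and only if every even cycle of G extends to an ear decomposition of G, i.e., for every even cycle C of G there is an ear decomposition (G_0, G_1, …, G_r) of G with G_0 = C. -/
open SimpleGraph

variable {V : Type*}

/-- A matching covered graph: a connected graph with at least two vertices in which
every edge belongs to some perfect matching. -/
def MatchingCovered (G : SimpleGraph V) : Prop :=
  G.Connected ∧ Nontrivial V ∧
    ∀ e ∈ G.edgeSet, ∃ M : G.Subgraph, M.IsPerfectMatching ∧ e ∈ M.edgeSet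

/-- A cycle `C` is conformal if `G - V(C)` has a perfect matching. -/
def ConformalCycle (G : SimpleGraph V) {u : V} (C : G.Walk u u) : Prop :=
  ∃ M : G.Subgraph, M.IsMatching ∧ M.verts = {w | w ∉ C.support}

/-- A matching covered graph is cycle-extendable if each of its even cycles is conformal. -/
def CycleExtendable (G : SimpleGraph V) : Prop :=
  ∀ ⦃u : V⦄ (C : G.Walk u u), C.IsCycle → Even C.length → ConformalCycle G C

/-- A single ear of a subgraph `H` in `G`: an odd path whose ends are in `H`
but which is otherwise disjoint from `H`. -/
def IsSingleEar (G : SimpleGraph V) (H : G.Subgraph) {u v : V} (P : G.Walk u v) : Prop :=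
  P.IsPath ∧ Odd P.length ∧ u ∈ H.verts ∧ v ∈ H.verts ∧
    (∀ w ∈ P.support, w ≠ u → w ≠ v → w ∉ H.verts) ∧
    (∀ e ∈ P.edges, e ∉ H.edgeSet)

/-- One step of an ear decomposition: `H'` is obtained from `H` by adding a single ear
or a double ear (a pair of vertex-disjoint single ears). -/
def EarStep (G : SimpleGraph V) (H H' : G.Subgraph) : Prop :=
  (∃ (u v : V) (P : G.Walk u v), IsSingleEar G H P ∧ H' = H ⊔ P.toSubgraph) ∨
  (∃ (u v a b : V) (P₁ : G.Walk u v) (P₂ : G.Walk a b),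
      IsSingleEar G H P₁ ∧ IsSingleEar G H P₂ ∧
      (∀ w ∈ P₁.support, w ∉ P₂.support) ∧
      H' = H ⊔ P₁.toSubgraph ⊔ P₂.toSubgraph)

/-- An ear decomposition of a matching covered graph `G`: a sequence of matching covered
subgraphs starting at an even cycle, ending at `G`, each obtained from the previous one
by adding a single or a double ear. -/
def IsEarDecomposition (G : SimpleGraph V) (r : ℕ) (Gs : Fin (r + 1) → G.Subgraph) : Prop :=
  (∃ (v : V) (C : G.Walk v v), C.IsCycle ∧ Even C.length ∧ Gs 0 = C.toSubgraph) ∧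
  Gs (Fin.last r) = ⊤ ∧
  (∀ i, MatchingCovered (Gs i).coe) ∧
  (∀ i : Fin r, EarStep G (Gs i.castSucc) (Gs i.succ))

/-- A blob of a bipartite relation: a set of left vertices together with a set of right vertices
that contains all its neighbours and has exactly one more element. -/
def IsBlob {A K : Type*} (r : A → K → Prop) (Y : Finset A) (D : Finset K) : Prop :=
  (∀ a ∈ Y, ∀ k, r a k → k ∈ D) ∧ D.card = Y.card + 1

/-- Two right vertices are linked off `P` if some blob avoiding `P` contains both. -/
def Linked {A K : Type*} (r : A → K → Prop) (P : Set A) (k k' : K) : Prop :=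
  ∃ Y D, IsBlob r Y D ∧ (∀ a ∈ Y, a ∉ P) ∧ k ∈ D ∧ k' ∈ D

/-- Every nonempty proper set of left vertices has more neighbours than elements. -/
def Expanding {A K : Type*} (r : A → K → Prop) : Prop :=
  ∀ (Y : Finset A) (D : Finset K), Y.Nonempty → (∃ a, a ∉ Y) →
    (∀ a ∈ Y, ∀ k, r a k → k ∈ D) → Y.card + 1 ≤ D.card

section Bipartite

variable {A K : Type*} {r : A → K → Prop}

open Classical in
theorem IsBlob.inter_union (hN : Expanding r) {Y Y' : Finset A} {D D' : Finset K}
    (h : IsBlob r Y D) (h' : IsBlob r Y' D') {k : K} (hk : k ∈ D) (hk' : k ∈ D')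
    {a : A} (ha : a ∉ Y) (ha' : a ∉ Y') :
    IsBlob r (Y ∩ Y') (D ∩ D') ∧ IsBlob r (Y ∪ Y') (D ∪ D') := by
  have n1 : ∀ a ∈ Y ∩ Y', ∀ k, r a k → k ∈ D ∩ D' := by
    intro b hb l hl
    rw [Finset.mem_inter] at hb ⊢
    exact ⟨h.1 b hb.1 l hl, h'.1 b hb.2 l hl⟩
  have n2 : ∀ a ∈ Y ∪ Y', ∀ k, r a k → k ∈ D ∪ D' := by
    intro b hb l hl
    rw [Finset.mem_union] at hb ⊢
    exact hb.imp (fun hb => h.1 b hb l hl) (fun hb => h'.1 b hb l hl)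
  have e1 := Finset.card_union_add_card_inter Y Y'
  have e2 := Finset.card_union_add_card_inter D D'
  have l1 : (Y ∩ Y').card + 1 ≤ (D ∩ D').card := by
    rcases (Y ∩ Y').eq_empty_or_nonempty with h0 | h0
    · rw [h0]
      simpa using Finset.card_pos.2 ⟨k, Finset.mem_inter.2 ⟨hk, hk'⟩⟩
    · exact hN _ _ h0 ⟨a, by simp [ha]⟩ n1
  have l2 : (Y ∪ Y').card + 1 ≤ (D ∪ D').card := by
    rcases (Y ∪ Y').eq_empty_or_nonempty with h0 | h0
    · rw [h0]
      simpa using Finset.card_pos.2 ⟨k, Finset.mem_union.2 (Or.inl hk)⟩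
    · exact hN _ _ h0 ⟨a, by simp [ha, ha']⟩ n2
  have c := h.2
  have c' := h'.2
  exact ⟨⟨n1, by omega⟩, ⟨n2, by omega⟩⟩

theorem Linked.refl (P : Set A) (k : K) : Linked r P k k :=
  ⟨∅, {k}, ⟨by simp, by simp⟩, by simp, by simp, by simp⟩

theorem Linked.symm {P : Set A} {k k' : K} (h : Linked r P k k') : Linked r P k' k := by
  obtain ⟨Y, D, h1, h2, h3, h4⟩ := h
  exact ⟨Y, D, h1, h2, h4, h3⟩

theorem Linked.mono {P P' : Set A} (hP : P ⊆ P') {k k' : K} (h : Linked r P' k k') :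
    Linked r P k k' := by
  obtain ⟨Y, D, h1, h2, h3, h4⟩ := h
  exact ⟨Y, D, h1, fun a ha hp => h2 a ha (hP hp), h3, h4⟩

theorem Linked.trans (hN : Expanding r) {P : Set A} (hP : P.Nonempty) {k k' k'' : K}
    (h : Linked r P k k') (h' : Linked r P k' k'') : Linked r P k k'' := by
  classical
  obtain ⟨p, hp⟩ := hP
  obtain ⟨Y, D, h1, h2, h3, h4⟩ := h
  obtain ⟨Y', D', h1', h2', h3', h4'⟩ := h'
  refine ⟨Y ∪ Y', D ∪ D', (h1.inter_union hN h1' h4 h3' (fun hy => h2 p hy hp)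
    (fun hy => h2' p hy hp)).2, ?_, by simp [h3], by simp [h4']⟩
  intro a ha
  rcases Finset.mem_union.1 ha with ha | ha
  · exact h2 a ha
  · exact h2' a ha

open Classical in
/-- The class of right vertices linked to a given one is itself a blob. -/
theorem exists_isBlob_linked [Fintype K] (hN : Expanding r) {P : Set A} (hP : P.Nonempty)
    (k : K) :
    ∃ Y, IsBlob r Y (Finset.univ.filter (Linked r P k)) ∧ ∀ a ∈ Y, a ∉ P := by
  let F : Finset (Finset K) :=
    Finset.univ.filter fun D => k ∈ D ∧ ∃ Y, IsBlob r Y D ∧ ∀ a ∈ Y, a ∉ P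
  have hF : F.Nonempty :=
    ⟨{k}, by
      simp only [F, Finset.mem_filter, Finset.mem_univ, true_and, Finset.mem_singleton]
      exact ⟨∅, ⟨by simp, by simp⟩, by simp⟩⟩
  obtain ⟨D, hD, hmax⟩ := Finset.exists_max_image F Finset.card hF
  simp only [F, Finset.mem_filter, Finset.mem_univ, true_and] at hD hmax
  obtain ⟨hkD, Y, hY, hYP⟩ := hD
  obtain ⟨p, hp⟩ := hP
  have : Finset.univ.filter (Linked r P k) = D := by
    ext l
    simp only [Finset.mem_filter, Finset.mem_univ, true_and]
    constructor
    · rintro ⟨Y', D', h1, h2, h3, h4⟩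
      have hu := (hY.inter_union hN h1 hkD h3 (fun hy => hYP p hy hp) (fun hy => h2 p hy hp)).2
      have hle := hmax (D ∪ D') ⟨by simp [hkD], Y ∪ Y', hu, fun a ha =>
        (Finset.mem_union.1 ha).elim (hYP a) (h2 a)⟩
      have := Finset.eq_of_subset_of_card_le Finset.subset_union_left hle
      rw [this]
      exact Finset.mem_union_right _ h4
    · intro hl
      exact ⟨Y, D, hY, hYP, hkD, hl⟩
  rw [this]
  exact ⟨Y, hY, hYP⟩

/-- If two right vertices are linked off `P ∪ Q i` for each `i`, they are linked off
the union of the `Q i`. -/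
theorem linked_iUnion (hN : Expanding r) {ι : Type*} {P : Set A} (hP : P.Nonempty)
    {Q : ι → Set A} {k k' : K} (h0 : Linked r P k k') (h : ∀ i, Linked r (P ∪ Q i) k k') :
    Linked r (⋃ i, Q i) k k' := by
  classical
  obtain ⟨p, hp⟩ := hP
  have key : ∀ n, ∀ Y : Finset A, Y.card = n → ∀ D, IsBlob r Y D → (∀ a ∈ Y, a ∉ P) → k ∈ D →
      k' ∈ D → Linked r (⋃ i, Q i) k k' := by
    intro n
    induction n using Nat.strong_induction_on with
    | _ n ih =>
      intro Y hn D hD hYP hk hk'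
      by_cases hall : ∀ a ∈ Y, a ∉ ⋃ i, Q i
      · exact ⟨Y, D, hD, hall, hk, hk'⟩
      · push Not at hall
        obtain ⟨a, haY, ha⟩ := hall
        obtain ⟨i, hi⟩ := Set.mem_iUnion.1 ha
        obtain ⟨Y', D', h1, h2, h3, h4⟩ := h i
        have hI := (hD.inter_union hN h1 hk h3 (fun hy => hYP p hy hp)
          (fun hy => h2 p hy (Or.inl hp))).1
        have hlt : (Y ∩ Y').card < Y.card := by
          apply Finset.card_lt_card
          refine ⟨Finset.inter_subset_left, fun hs => ?_⟩
          exact h2 a (Finset.mem_inter.1 (hs haY)).2 (Or.inr hi)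
        exact ih _ (hn ▸ hlt) _ rfl _ hI (fun b hb => hYP b (Finset.mem_inter.1 hb).1)
          (by simp [hk, h3]) (by simp [hk', h4])
  obtain ⟨Y, D, h1, h2, h3, h4⟩ := h0
  exact key _ Y rfl D h1 h2 h3 h4

open Classical in
/-- If `q` does not leave the classes of the relation of being linked off `O` inside a union `S`
of such classes, a map with the right parities hits `S` at least `S.card` times. -/
theorem card_le_card_preimage [Fintype A] [Fintype K] (hN : Expanding r) {O : Set A}
    (hO : O.Nonempty) {q : K → K → Prop} {ν : A → K} (hν : ∀ a ∉ O, r a (ν a))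
    (hpar : ∀ D : Finset K, (∀ k ∈ D, ∀ k', q k k' → k' ∈ D) →
      (Even (Finset.univ.filter fun a => a ∉ O ∧ ν a ∈ D).card ↔ Even D.card))
    (S : Finset K) (hS : ∀ k ∈ S, ∀ k', Linked r O k k' → k' ∈ S)
    (hq : ∀ k ∈ S, ∀ k', q k k' → Linked r O k k') :
    S.card ≤ (Finset.univ.filter fun a => a ∉ O ∧ ν a ∈ S).card := by
  induction S using Finset.strongInduction with
  | _ S ih =>
    rcases S.eq_empty_or_nonempty with rfl | ⟨k, hk⟩
    · simp
    obtain ⟨Y, hY, hYO⟩ := exists_isBlob_linked hN hO k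
    set D := Finset.univ.filter (Linked r O k) with hD
    have memD : ∀ l, l ∈ D ↔ Linked r O k l := by simp [hD]
    have hDS : D ⊆ S := fun l hl => hS k hk l ((memD l).1 hl)
    have hkD : k ∈ D := (memD k).2 (Linked.refl O k)
    have step := ih (S \ D) (Finset.sdiff_ssubset hDS ⟨k, hkD⟩)
      (by
        intro l hl l' hll'
        rw [Finset.mem_sdiff, memD] at hl ⊢
        exact ⟨hS l hl.1 l' hll', fun h => hl.2 (h.trans hN hO hll'.symm)⟩)
      (fun l hl => hq l (Finset.mem_sdiff.1 hl).1)
    have par := hpar D (by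
      intro l hl l' hll'
      rw [memD] at hl ⊢
      exact hl.trans hN hO (hq l (hDS ((memD l).2 hl)) l' hll'))
    have hsub : Y ⊆ Finset.univ.filter fun a => a ∉ O ∧ ν a ∈ D := by
      intro a ha
      simp only [Finset.mem_filter, Finset.mem_univ, true_and]
      exact ⟨hYO a ha, hY.1 a ha _ (hν a (hYO a ha))⟩
    have hle := Finset.card_le_card hsub
    have hYD := hY.2
    have hge : D.card ≤ (Finset.univ.filter fun a => a ∉ O ∧ ν a ∈ D).card := by
      rcases hle.lt_or_eq with h | h
      · omega
      · rw [← h, hYD, Nat.even_add_one] at par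
        exact absurd par iff_not_self
    have hsplit : (Finset.univ.filter fun a => a ∉ O ∧ ν a ∈ S).card =
        (Finset.univ.filter fun a => a ∉ O ∧ ν a ∈ D).card +
        (Finset.univ.filter fun a => a ∉ O ∧ ν a ∈ S \ D).card := by
      rw [← Finset.card_union_of_disjoint]
      · congr 1
        ext a
        have := @hDS (ν a)
        simp only [Finset.mem_filter, Finset.mem_univ, true_and, Finset.mem_union,
          Finset.mem_sdiff]
        tauto
      · rw [Finset.disjoint_left]
        intro a
        simp only [Finset.mem_filter, Finset.mem_univ, true_and, Finset.mem_sdiff]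
        tauto
    have := Finset.card_sdiff_add_card_eq_card hDS
    omega

/-- The bipartite heart of the two ear theorem. -/
theorem exists_not_linked_pair [Fintype A] [Fintype K] (hN : Expanding r)
    (hcard : Fintype.card A = Fintype.card K) {O : Set A} (hO : O.Nonempty) {σ : A → A}
    (hσ : ∀ a ∈ O, σ a ∈ O ∧ σ a ≠ a) {q : K → K → Prop}
    {ν : A → K} (hν : ∀ a ∉ O, r a (ν a))
    (hpar : ∀ D : Finset K, (∀ k ∈ D, ∀ k', q k k' → k' ∈ D) → by
      classical
      exact (Even (Finset.univ.filter fun a => a ∉ O ∧ ν a ∈ D).card ↔ Even D.card)) :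
    ∃ a ∈ O, ∃ k k', q k k' ∧ ¬ Linked r {a, σ a} k k' := by
  classical
  by_contra! hcon
  have hne : ∀ a : A, ({a, σ a} : Set A).Nonempty := fun a => ⟨a, by simp⟩
  -- no class of a pair absorbs all the relevant `q`-edges
  have habs : ∀ a ∈ O, ∀ k₀, ∃ k k', q k k' ∧ ¬ Linked r O k k' ∧
      ¬ Linked r {a, σ a} k₀ k := by
    intro a ha k₀
    by_contra! hno
    obtain ⟨Y, hY, hYa⟩ := exists_isBlob_linked hN (hne a) k₀
    set C := Finset.univ.filter (Linked r {a, σ a} k₀) with hC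
    have memC : ∀ l, l ∈ C ↔ Linked r {a, σ a} k₀ l := by simp [hC]
    have hsubO : ({a, σ a} : Set A) ⊆ O := by
      intro b hb
      rcases hb with rfl | rfl
      · exact ha
      · exact (hσ a ha).1
    have hle := card_le_card_preimage hN hO hν hpar Cᶜ
      (by
        intro k hk k' hkk'
        rw [Finset.mem_compl, memC] at hk ⊢
        exact fun h => hk (h.trans hN (hne a) (hkk'.symm.mono hsubO)))
      (by
        intro k hk k' hkk'
        rw [Finset.mem_compl, memC] at hk
        by_contra h
        exact hk (hno k k' hkk' h))
    have hsub : (Finset.univ.filter fun b => b ∉ O ∧ ν b ∈ Cᶜ) ⊆ (Y ∪ {a, σ a})ᶜ := by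
      intro b
      simp only [Finset.mem_filter, Finset.mem_univ, true_and, Finset.mem_compl,
        Finset.mem_union, Finset.mem_insert, Finset.mem_singleton]
      rintro ⟨hb, hbC⟩ (hbY | rfl | rfl)
      · exact hbC (hY.1 b hbY _ (hν b hb))
      · exact hb ha
      · exact hb (hσ a ha).1
    have hle' := Finset.card_le_card hsub
    have hdisj : Disjoint Y {a, σ a} := by
      rw [Finset.disjoint_left]
      intro b hb hb'
      exact hYa b hb (by simpa using hb')
    have c1 := Finset.card_add_card_compl (Y ∪ {a, σ a})
    rw [Finset.card_union_of_disjoint hdisj, Finset.card_pair (hσ a ha).2.symm] at c1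
    have c2 := Finset.card_add_card_compl C
    have := hY.2
    omega
  obtain ⟨a₀, ha₀⟩ := hO
  let T : Finset (A × K) := Finset.univ.filter fun p =>
    p.1 ∈ O ∧ ∃ k', q p.2 k' ∧ ¬ Linked r O p.2 k'
  have hT : T.Nonempty := by
    obtain ⟨k, k', h1, h2, -⟩ := habs a₀ ha₀ (ν a₀)
    refine ⟨(a₀, k), ?_⟩
    simp only [T, Finset.mem_filter, Finset.mem_univ, true_and]
    exact ⟨ha₀, k', h1, h2⟩
  obtain ⟨⟨a, k⟩, hak, hmin⟩ := Finset.exists_min_image T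
    (fun p => (Finset.univ.filter (Linked r {p.1, σ p.1} p.2)).card) hT
  simp only [T, Finset.mem_filter, Finset.mem_univ, true_and, Prod.forall] at hak hmin
  obtain ⟨ha, k', hkk', hnot⟩ := hak
  -- the pair of `k` and `k'` separates the pair of `a` from another one
  obtain ⟨b, hb, hsep⟩ : ∃ b ∈ O, ¬ Linked r ({a, σ a} ∪ {b, σ b}) k k' := by
    by_contra! hall
    apply hnot
    refine (linked_iUnion hN (hne a) (Q := fun b : O => {b.1, σ b.1})
      (hcon a ha k k' hkk') (fun b => hall b.1 b.2)).mono ?_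
    intro b hb
    exact Set.mem_iUnion.2 ⟨⟨b, hb⟩, by simp⟩
  have hcover : ∀ l, Linked r {a, σ a} k l ∨ Linked r {b, σ b} k l := by
    obtain ⟨Y, D, h1, h2, h3, h4⟩ := hcon a ha k k' hkk'
    obtain ⟨Y', D', h1', h2', h3', h4'⟩ := hcon b hb k k' hkk'
    have hall : ∀ c, c ∈ Y ∨ c ∈ Y' := by
      by_contra! hc
      obtain ⟨c, hc, hc'⟩ := hc
      refine hsep ⟨_, _, (h1.inter_union hN h1' h3 h3' hc hc').1, ?_, by simp [h3, h3'],
        by simp [h4, h4']⟩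
      intro d hd hd'
      rw [Finset.mem_inter] at hd
      exact hd'.elim (h2 d hd.1) (h2' d hd.2)
    intro l
    have hl : l ∈ D ∪ D' := by
      have hn := hN (Finset.univ.erase a) (D ∪ D')
        ⟨σ a, by simp [(hσ a ha).2]⟩ ⟨a, by simp⟩
        (by
          intro c _ m hm
          rw [Finset.mem_union]
          exact (hall c).imp (fun h => h1.1 c h m hm) (fun h => h1'.1 c h m hm))
      rw [Finset.card_erase_of_mem (Finset.mem_univ a), Finset.card_univ] at hn
      have : D ∪ D' = Finset.univ := by
        apply Finset.eq_univ_of_card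
        have := Finset.card_le_univ (D ∪ D')
        have : 0 < Fintype.card A := Fintype.card_pos_iff.2 ⟨a⟩
        omega
      rw [this]
      exact Finset.mem_univ l
    exact (Finset.mem_union.1 hl).imp (fun h => ⟨Y, D, h1, h2, h3, h⟩)
      (fun h => ⟨Y', D', h1', h2', h3', h⟩)
  obtain ⟨l, l', hll', hl, hkl⟩ := habs b hb k
  refine absurd (hmin b l ⟨hb, l', hll', hl⟩) (not_le.2 (Finset.card_lt_card ?_))
  refine ⟨fun m hm => ?_, fun hs => ?_⟩
  · simp only [Finset.mem_filter, Finset.mem_univ, true_and] at hm ⊢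
    exact (hcover m).resolve_right fun h => hkl (h.trans hN (hne b) hm.symm)
  · have : k ∈ Finset.univ.filter (Linked r {a, σ a} k) := by simp [Linked.refl]
    have := hs this
    simp only [Finset.mem_filter, Finset.mem_univ, true_and] at this
    exact hkl this.symm

end Bipartite

/-- The map `m` restricts to a perfect matching, in the graph `G`, of the vertex set `S`. -/
def MatchesOn {W : Type*} (G : SimpleGraph W) (S : Set W) (m : W → W) : Prop :=
  ∀ w ∈ S, m w ∈ S ∧ G.Adj w (m w) ∧ m (m w) = w

section Matchings

variable {W : Type*} {G : SimpleGraph W}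

theorem MatchesOn.mono {G' : SimpleGraph W} (hG : G ≤ G') {S : Set W} {m : W → W}
    (h : MatchesOn G S m) : MatchesOn G' S m :=
  fun w hw => ⟨(h w hw).1, hG (h w hw).2.1, (h w hw).2.2⟩

theorem MatchesOn.congr {S : Set W} {m m' : W → W} (h : MatchesOn G S m)
    (hm : Set.EqOn m' m S) : MatchesOn G S m' := by
  intro w hw
  obtain ⟨h1, h2, h3⟩ := h w hw
  rw [hm hw, hm h1]
  exact ⟨h1, h2, h3⟩

theorem matchesOn_empty (m : W → W) : MatchesOn G ∅ m := fun _ hw => hw.elim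

theorem MatchesOn.exists_union {S T : Set W} {m m' : W → W} (h : MatchesOn G S m)
    (h' : MatchesOn G T m') (hd : Disjoint S T) :
    ∃ n, MatchesOn G (S ∪ T) n ∧ Set.EqOn n m S ∧ Set.EqOn n m' T := by
  classical
  have e1 : Set.EqOn (S.piecewise m m') m S := Set.piecewise_eqOn _ _ _
  have e2 : Set.EqOn (S.piecewise m m') m' T := fun w hw =>
    Set.piecewise_eq_of_notMem _ _ _ (Set.disjoint_right.1 hd hw)
  refine ⟨S.piecewise m m', ?_, e1, e2⟩
  rintro w (hw | hw)
  · obtain ⟨h1, h2⟩ := h.congr e1 w hw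
    exact ⟨Or.inl h1, h2⟩
  · obtain ⟨h1, h2⟩ := h'.congr e2 w hw
    exact ⟨Or.inr h1, h2⟩

theorem exists_matchesOn_iUnion {ι : Type*} {S : ι → Set W}
    (hd : Pairwise fun i j => Disjoint (S i) (S j)) (h : ∀ i, ∃ m, MatchesOn G (S i) m) :
    ∃ m, MatchesOn G (⋃ i, S i) m := by
  classical
  choose m hm using h
  let n : W → W := fun w => if hw : ∃ i, w ∈ S i then m hw.choose w else w
  have hn : ∀ i, Set.EqOn n (m i) (S i) := by
    intro i w hw
    have hex : ∃ i, w ∈ S i := ⟨i, hw⟩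
    have : hex.choose = i := by
      by_contra hne
      exact Set.disjoint_left.1 (hd hne) hex.choose_spec hw
    simp only [n, dif_pos hex, this]
  refine ⟨n, fun w hw => ?_⟩
  obtain ⟨i, hi⟩ := Set.mem_iUnion.1 hw
  obtain ⟨h1, h2⟩ := (hm i).congr (hn i) w hi
  exact ⟨Set.mem_iUnion.2 ⟨i, h1⟩, h2⟩

theorem exists_matchesOn_pair {a b : W} (hab : G.Adj a b) :
    ∃ m, MatchesOn G {a, b} m ∧ m a = b ∧ m b = a := by
  classical
  have h1 : Equiv.swap a b a = b := Equiv.swap_apply_left a b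
  have h2 : Equiv.swap a b b = a := Equiv.swap_apply_right a b
  refine ⟨Equiv.swap a b, ?_, h1, h2⟩
  rintro w (rfl | rfl)
  · rw [h1, h2]
    exact ⟨by simp, hab, rfl⟩
  · rw [h2, h1]
    exact ⟨by simp, hab.symm, rfl⟩

theorem even_card_of_involution {α : Type*} (s : Finset α) (f : α → α)
    (h : ∀ x ∈ s, f x ∈ s ∧ f x ≠ x ∧ f (f x) = x) : Even s.card := by
  have : ∑ x ∈ s, (1 : ZMod 2) = 0 :=
    Finset.sum_involution (fun x _ => f x) (fun _ _ => by decide)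
      (fun x hx _ => (h x hx).2.1) (fun x hx => (h x hx).1) (fun x hx => (h x hx).2.2)
  rw [Finset.sum_const, nsmul_eq_mul, mul_one] at this
  exact (ZMod.natCast_eq_zero_iff_even).1 this

theorem MatchesOn.even_card {S : Finset W} {m : W → W} (h : MatchesOn G S m) : Even S.card :=
  even_card_of_involution S m fun x hx =>
    ⟨(h x hx).1, (h x hx).2.1.ne', (h x hx).2.2⟩

theorem SimpleGraph.Subgraph.IsMatching.exists_matchesOn {M : G.Subgraph} (hM : M.IsMatching) :
    ∃ m, MatchesOn G M.verts m ∧ ∀ a b, M.Adj a b → m a = b := by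
  classical
  have hex : ∀ w ∈ M.verts, ∃ x, M.Adj w x := fun w hw => (hM hw).exists
  let m : W → W := fun w => if hw : ∃ x, M.Adj w x then hw.choose else w
  have hm : ∀ a b, M.Adj a b → m a = b := by
    intro a b hab
    have h : ∃ x, M.Adj a x := ⟨b, hab⟩
    simp only [m, dif_pos h]
    exact (hM (M.edge_vert hab)).unique h.choose_spec hab
  refine ⟨m, fun w hw => ?_, hm⟩
  obtain ⟨x, hx⟩ := hex w hw
  rw [hm w x hx]
  exact ⟨M.edge_vert hx.symm, hx.adj_sub, hm x w hx.symm⟩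

theorem MatchesOn.exists_isMatching {S : Set W} {m : W → W} (h : MatchesOn G S m) :
    ∃ M : G.Subgraph, M.IsMatching ∧ M.verts = S ∧ ∀ w ∈ S, M.Adj w (m w) := by
  let M : G.Subgraph :=
    { verts := S
      Adj := fun a b => a ∈ S ∧ m a = b
      adj_sub := by
        rintro a b ⟨ha, rfl⟩
        exact (h a ha).2.1
      edge_vert := fun hab => hab.1
      symm := ⟨by
        rintro a b ⟨ha, rfl⟩
        exact ⟨(h a ha).1, (h a ha).2.2⟩⟩ }
  refine ⟨M, fun w hw => ⟨m w, ⟨hw, rfl⟩, ?_⟩, rfl, fun w hw => ⟨hw, rfl⟩⟩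
  rintro y ⟨-, rfl⟩
  rfl

/-- One direction of Tutte's theorem, for the subgraph induced on `S`. -/
theorem exists_odd_family_of_not_matchesOn [Finite W] (G : SimpleGraph W) (S : Finset W)
    (h : ¬ ∃ m, MatchesOn G S m) :
    ∃ (X : Finset W) (F : Finset (Finset W)), X ⊆ S ∧
      (∀ k ∈ F, Odd k.card ∧ k ⊆ S ∧ Disjoint k X ∧
        ∀ x ∈ k, ∀ y ∈ S, G.Adj x y → y ∈ k ∨ y ∈ X) ∧
      (∀ k ∈ F, ∀ l ∈ F, k ≠ l → Disjoint k l) ∧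
      X.card < F.card ∧ Even (F.card + X.card + S.card) := by
  classical
  have hno : ¬ ∃ M : (G.induce (S : Set W)).Subgraph, M.IsPerfectMatching := by
    rintro ⟨M, hM⟩
    obtain ⟨m, hm, -⟩ := hM.1.exists_matchesOn
    rw [Subgraph.isSpanning_iff.1 hM.2] at hm
    apply h
    refine ⟨fun w => if hw : w ∈ S then m ⟨w, hw⟩ else w, fun w hw => ?_⟩
    have hw : w ∈ S := hw
    obtain ⟨-, h2, h3⟩ := hm ⟨w, hw⟩ trivial
    have hs := (m ⟨w, hw⟩).2
    simp only [dif_pos hw]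
    refine ⟨hs, h2, ?_⟩
    have hs' : (m ⟨w, hw⟩ : W) ∈ S := hs
    rw [dif_pos hs']
    simp [h3]
  rw [SimpleGraph.tutte] at hno
  push Not at hno
  obtain ⟨u, hu⟩ := hno
  have := Fintype.ofFinite W
  set D := ((⊤ : (G.induce (S : Set W)).Subgraph).deleteVerts u) with hD
  let val : D.verts → W := fun v => v.1.1
  have hval : Function.Injective val := fun a b hab => Subtype.ext (Subtype.ext hab)
  let im : D.coe.ConnectedComponent → Finset W := fun c => c.supp.toFinset.image val
  have him : Function.Injective im := by
    intro c c' hcc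
    have := Finset.image_injective hval hcc
    exact ConnectedComponent.supp_injective (Set.toFinset_inj.1 this)
  have hdis : ∀ c c', c ≠ c' → Disjoint (im c) (im c') := by
    intro c c' hne
    rw [Finset.disjoint_left]
    intro x hx hx'
    simp only [im, Finset.mem_image, Set.mem_toFinset, ConnectedComponent.mem_supp_iff] at hx hx'
    obtain ⟨a, ha, rfl⟩ := hx
    obtain ⟨b, hb, hab⟩ := hx'
    rw [hval hab, ha] at hb
    exact hne hb
  have memD : ∀ v, v ∈ D.verts ↔ v ∉ u := by simp [hD]
  have cu : (u.toFinset.image Subtype.val).card = u.ncard := by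
    rw [Finset.card_image_of_injective _ Subtype.val_injective, Set.ncard_eq_toFinset_card']
  have cF : (D.coe.oddComponents.toFinset.image im).card = D.coe.oddComponents.ncard := by
    rw [Finset.card_image_of_injective _ him, Set.ncard_eq_toFinset_card']
  refine ⟨u.toFinset.image Subtype.val, D.coe.oddComponents.toFinset.image im, ?_, ?_, ?_, ?_, ?_⟩
  · intro x hx
    simp only [Finset.mem_image, Set.mem_toFinset] at hx
    obtain ⟨a, -, rfl⟩ := hx
    exact a.2
  · intro k hk
    simp only [Finset.mem_image, Set.mem_toFinset] at hk
    obtain ⟨c, hc, rfl⟩ := hk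
    refine ⟨?_, ?_, ?_, ?_⟩
    · simp only [im]
      rw [Finset.card_image_of_injective _ hval, ← Set.ncard_eq_toFinset_card']
      exact hc
    · intro x hx
      simp only [im, Finset.mem_image, Set.mem_toFinset] at hx
      obtain ⟨a, -, rfl⟩ := hx
      exact a.1.2
    · rw [Finset.disjoint_left]
      intro x hx hx'
      simp only [im, Finset.mem_image, Set.mem_toFinset] at hx hx'
      obtain ⟨a, -, rfl⟩ := hx
      obtain ⟨b, hb, hab⟩ := hx'
      have : b = a.1 := Subtype.ext hab
      exact (memD a.1).1 a.2 (this ▸ hb)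
    · intro x hx y hy hxy
      simp only [im, Finset.mem_image, Set.mem_toFinset] at hx ⊢
      obtain ⟨a, ha, rfl⟩ := hx
      by_cases hyu : (⟨y, hy⟩ : (S : Set W)) ∈ u
      · exact Or.inr ⟨_, hyu, rfl⟩
      · refine Or.inl ⟨⟨⟨y, hy⟩, (memD _).2 hyu⟩, ?_, rfl⟩
        refine c.mem_supp_of_adj_mem_supp ha ?_
        have hxy' : (G.induce (S : Set W)).Adj a.1 ⟨y, hy⟩ := hxy
        exact Subgraph.deleteVerts_adj.2 ⟨trivial, (memD _).1 a.2, trivial, hyu, hxy'⟩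
  · intro k hk l hl hkl
    simp only [Finset.mem_image, Set.mem_toFinset] at hk hl
    obtain ⟨c, -, rfl⟩ := hk
    obtain ⟨c', -, rfl⟩ := hl
    exact hdis c c' fun h => hkl (h ▸ rfl)
  · rw [cu, cF]
    exact hu
  · rw [cu, cF]
    have hodd := odd_ncard_oddComponents (G := D.coe)
    have hc : Nat.card D.verts + u.ncard = S.card := by
      have hv : D.verts = uᶜ := by
        ext v
        simp [memD]
      have := Set.ncard_add_ncard_compl u
      rw [hv, Nat.card_coe_set_eq]
      simp only [Nat.card_eq_fintype_card, Fintype.card_coe, SetLike.coe_sort_coe] at this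
      omega
    rw [← hc]
    rcases Nat.even_or_odd (Nat.card D.verts) with he | ho
    · have : Even D.coe.oddComponents.ncard := by
        rw [← Nat.not_odd_iff_even] at he ⊢
        exact fun h => he (hodd.1 h)
      grind
    · have := hodd.2 ho
      grind

end Matchings

/-- A family `F` of disjoint odd blocks, whose edges leave only towards `A`, that is at least as
large as `A`. -/
structure IsBarrier {W : Type*} (H : SimpleGraph W) (A : Finset W) (F : Finset (Finset W)) :
    Prop where
  odd : ∀ k ∈ F, Odd k.card
  disjoint : ∀ k ∈ F, Disjoint k A
  pairwise : ∀ k ∈ F, ∀ l ∈ F, k ≠ l → Disjoint k l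
  adj : ∀ k ∈ F, ∀ x ∈ k, ∀ y, H.Adj x y → y ∈ k ∨ y ∈ A
  card_le : A.card ≤ F.card

/-- A vertex of the barrier is related to the blocks in which it has a neighbour. -/
def blockRel {W : Type*} (H : SimpleGraph W) (A : Finset W) (F : Finset (Finset W))
    (a : {a // a ∈ A}) (k : {k // k ∈ F}) : Prop :=
  ∃ x ∈ k.1, H.Adj a.1 x

section Barriers

variable {W : Type*} {H : SimpleGraph W} {A : Finset W} {F : Finset (Finset W)}

theorem exists_isBarrier_of_not_matchesOn [Fintype W] (hW : Even (Fintype.card W)) {u v : W}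
    (huv : u ≠ v) (h : ¬ ∃ m, MatchesOn H {u, v}ᶜ m) :
    ∃ A F, IsBarrier H A F ∧ u ∈ A ∧ v ∈ A := by
  classical
  obtain ⟨X, F, hXS, hF, hdis, hlt, hev⟩ :=
    exists_odd_family_of_not_matchesOn H ({u, v}ᶜ : Finset W)
      (by rwa [Finset.coe_compl, Finset.coe_pair])
  have hc : ({u, v}ᶜ : Finset W).card + 2 = Fintype.card W := by
    rw [← Finset.card_pair huv, Finset.card_compl_add_card]
  have hXuv : Disjoint X {u, v} := by
    rw [Finset.disjoint_left]
    intro x hx hx'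
    exact (Finset.mem_compl.1 (hXS hx)) hx'
  refine ⟨X ∪ {u, v}, F, ⟨fun k hk => (hF k hk).1, ?_, hdis, ?_, ?_⟩, by simp, by simp⟩
  · intro k hk
    obtain ⟨-, h1, h2, -⟩ := hF k hk
    rw [Finset.disjoint_union_right]
    refine ⟨h2, ?_⟩
    rw [Finset.disjoint_left]
    intro x hx hx'
    exact (Finset.mem_compl.1 (h1 hx)) hx'
  · intro k hk x hx y hxy
    by_cases hy : y ∈ ({u, v} : Finset W)
    · exact Or.inr (Finset.mem_union_right _ hy)
    · rcases (hF k hk).2.2.2 x hx y (Finset.mem_compl.2 hy) hxy with h | h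
      · exact Or.inl h
      · exact Or.inr (Finset.mem_union_left _ h)
  · rw [Finset.card_union_of_disjoint hXuv, Finset.card_pair huv]
    grind

theorem IsBarrier.exists_matchesOn_erase [Finite W] [DecidableEq W] (hB : IsBarrier H A F)
    (hmax : ∀ A' F', IsBarrier H A' F' → A ⊆ A' → A'.card ≤ A.card) {k : Finset W} (hk : k ∈ F)
    {x : W} (hx : x ∈ k) : ∃ m, MatchesOn H (k.erase x) m := by
  classical
  by_contra hno
  obtain ⟨X, E, hXS, hE, hdis, hlt, hev⟩ := exists_odd_family_of_not_matchesOn H (k.erase x) hno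
  have hkc : (k.erase x).card + 1 = k.card := Finset.card_erase_add_one hx
  have hodd := hB.odd k hk
  have hkA := hB.disjoint k hk
  have hXk : X ⊆ k := hXS.trans (Finset.erase_subset _ _)
  have hxX : x ∉ X := fun h => (Finset.mem_erase.1 (hXS h)).1 rfl
  have hXA : Disjoint A X := (hkA.mono_left hXk).symm
  have hxA : x ∉ A := Finset.disjoint_left.1 hkA hx
  have hcard : (insert x (A ∪ X)).card = A.card + X.card + 1 := by
    rw [Finset.card_insert_of_notMem (by simp [hxA, hxX]), Finset.card_union_of_disjoint hXA]
  have hFE : Disjoint (F.erase k) E := by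
    rw [Finset.disjoint_left]
    intro l hl hl'
    obtain ⟨hlk, hlF⟩ := Finset.mem_erase.1 hl
    obtain ⟨ho, hs, -⟩ := hE l hl'
    obtain ⟨y, hy⟩ := Finset.card_pos.1 ho.pos
    exact Finset.disjoint_left.1 (hB.pairwise l hlF k hk hlk) hy (Finset.mem_of_mem_erase (hs hy))
  have hB' : IsBarrier H (insert x (A ∪ X)) (F.erase k ∪ E) := by
    have key : ∀ l ∈ F.erase k, ∀ l' ∈ E, Disjoint l l' := by
      intro l hl l' hl'
      obtain ⟨hlk, hlF⟩ := Finset.mem_erase.1 hl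
      exact (hB.pairwise l hlF k hk hlk).mono_right ((hE l' hl').2.1.trans (Finset.erase_subset _ _))
    refine ⟨?_, ?_, ?_, ?_, ?_⟩
    · intro l hl
      rcases Finset.mem_union.1 hl with hl | hl
      · exact hB.odd l (Finset.mem_of_mem_erase hl)
      · exact (hE l hl).1
    · intro l hl
      rw [Finset.disjoint_left]
      intro y hy hy'
      simp only [Finset.mem_insert, Finset.mem_union] at hy'
      rcases Finset.mem_union.1 hl with hl | hl
      · obtain ⟨hlk, hlF⟩ := Finset.mem_erase.1 hl
        have hd := Finset.disjoint_left.1 (hB.pairwise l hlF k hk hlk) hy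
        rcases hy' with rfl | h | h
        · exact hd hx
        · exact Finset.disjoint_left.1 (hB.disjoint l hlF) hy h
        · exact hd (hXk h)
      · obtain ⟨-, hs, hX, -⟩ := hE l hl
        rcases hy' with rfl | h | h
        · exact (Finset.mem_erase.1 (hs hy)).1 rfl
        · exact Finset.disjoint_left.1 hkA (Finset.mem_of_mem_erase (hs hy)) h
        · exact Finset.disjoint_left.1 hX hy h
    · intro l hl l' hl' hne
      rcases Finset.mem_union.1 hl with hl | hl <;> rcases Finset.mem_union.1 hl' with hl' | hl'
      · exact hB.pairwise l (Finset.mem_of_mem_erase hl) l' (Finset.mem_of_mem_erase hl') hne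
      · exact key l hl l' hl'
      · exact (key l' hl' l hl).symm
      · exact hdis l hl l' hl' hne
    · intro l hl y hy z hyz
      simp only [Finset.mem_insert, Finset.mem_union]
      rcases Finset.mem_union.1 hl with hl | hl
      · have := hB.adj l (Finset.mem_of_mem_erase hl) y hy z hyz
        tauto
      · obtain ⟨-, hs, -, ha⟩ := hE l hl
        rcases hB.adj k hk y (Finset.mem_of_mem_erase (hs hy)) z hyz with h | h
        · by_cases hzx : z = x
          · tauto
          · have := ha y hy z (Finset.mem_erase.2 ⟨hzx, h⟩) hyz
            tauto
        · tauto
    · rw [hcard, Finset.card_union_of_disjoint hFE]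
      have := Finset.card_erase_add_one hk
      have := hB.card_le
      grind
  have := hmax _ _ hB' fun y hy => Finset.mem_insert_of_mem (Finset.mem_union_left _ hy)
  omega

theorem IsBarrier.matching_bijective [Nonempty W] (hB : IsBarrier H A F) {m : W → W}
    (hm : MatchesOn H Set.univ m) :
    A.card = F.card ∧ (∀ a ∈ A, ∃ k ∈ F, m a ∈ k) ∧ (∀ k ∈ F, ∃ a ∈ A, m a ∈ k) ∧
      ∀ a ∈ A, ∀ a' ∈ A, ∀ k ∈ F, m a ∈ k → m a' ∈ k → a = a' := by
  classical
  have hmm : ∀ w, m (m w) = w := fun w => (hm w trivial).2.2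
  have hadj : ∀ w, H.Adj w (m w) := fun w => (hm w trivial).2.1
  have h1 : ∀ k ∈ F, ∃ x ∈ k, m x ∈ A := by
    intro k hk
    by_contra! hcon
    refine (Nat.not_even_iff_odd.2 (hB.odd k hk)) (even_card_of_involution k m fun x hx => ?_)
    exact ⟨(hB.adj k hk x hx _ (hadj x)).resolve_right (hcon x hx), (hadj x).ne', hmm x⟩
  choose! g hg hgA using h1
  have hinj : Set.InjOn (fun k => m (g k)) F := by
    intro k hk l hl hkl
    have : g k = g l := by rw [← hmm (g k), ← hmm (g l)]; exact congrArg m hkl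
    by_contra hne
    exact Finset.disjoint_left.1 (hB.pairwise k hk l hl hne) (hg k hk) (this ▸ hg l hl)
  have hmaps : Set.MapsTo (fun k => m (g k)) F A := fun k hk => hgA k hk
  have hsurj := Finset.surjOn_of_injOn_of_card_le _ hmaps hinj hB.card_le
  have huniq : ∀ a ∈ A, ∀ k ∈ F, m a ∈ k → a = m (g k) := by
    intro a ha k hk hak
    obtain ⟨l, hl, rfl⟩ := hsurj ha
    simp only [hmm] at hak ⊢
    by_cases hkl : l = k
    · rw [hkl]
    · exact (Finset.disjoint_left.1 (hB.pairwise l hl k hk hkl) (hg l hl) hak).elim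
  refine ⟨le_antisymm hB.card_le (Finset.card_le_card_of_injOn _ hmaps hinj), ?_, ?_, ?_⟩
  · intro a ha
    obtain ⟨k, hk, rfl⟩ := hsurj ha
    exact ⟨k, hk, by simpa only [hmm] using hg k hk⟩
  · intro k hk
    exact ⟨m (g k), hgA k hk, by simpa only [hmm] using hg k hk⟩
  · intro a ha a' ha' k hk h h'
    rw [huniq a ha k hk h, huniq a' ha' k hk h']

theorem SimpleGraph.Connected.exists_adj_mem_notMem (hH : H.Connected) {T : Set W} {a b : W}
    (ha : a ∈ T) (hb : b ∉ T) : ∃ x y, H.Adj x y ∧ x ∈ T ∧ y ∉ T := by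
  obtain ⟨p⟩ := hH.preconnected a b
  obtain ⟨d, -, h1, h2⟩ := p.exists_boundary_dart T ha hb
  exact ⟨d.fst, d.snd, d.adj, h1, h2⟩

theorem IsBarrier.not_adj (hB : IsBarrier H A F)
    (hPM : ∀ a b, H.Adj a b → ∃ m, MatchesOn H Set.univ m ∧ m a = b) {a b : W} (ha : a ∈ A)
    (hb : b ∈ A) : ¬ H.Adj a b := by
  intro hab
  have : Nonempty W := ⟨a⟩
  obtain ⟨m, hm, rfl⟩ := hPM a b hab
  obtain ⟨k, hk, hak⟩ := (hB.matching_bijective hm).2.1 a ha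
  exact Finset.disjoint_left.1 (hB.disjoint k hk) hak hb

theorem IsBarrier.mem_or_mem (hB : IsBarrier H A F) (hH : H.Connected)
    (hPM : ∀ a b, H.Adj a b → ∃ m, MatchesOn H Set.univ m ∧ m a = b) (hA : A.Nonempty) (w : W) :
    w ∈ A ∨ ∃ k ∈ F, w ∈ k := by
  by_contra hw
  have : Nonempty W := ⟨w⟩
  obtain ⟨a, ha⟩ := hA
  obtain ⟨x, y, hxy, hx, hy⟩ := hH.exists_adj_mem_notMem
    (T := {w | w ∈ A ∨ ∃ k ∈ F, w ∈ k}) (Or.inl ha) hw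
  rcases hx with hx | ⟨k, hk, hx⟩
  · obtain ⟨m, hm, rfl⟩ := hPM x y hxy
    exact hy (Or.inr ((hB.matching_bijective hm).2.1 x hx))
  · rcases hB.adj k hk x hx y hxy with h | h
    · exact hy (Or.inr ⟨k, hk, h⟩)
    · exact hy (Or.inl h)

theorem IsBarrier.expanding (hB : IsBarrier H A F) (hH : H.Connected)
    (hPM : ∀ a b, H.Adj a b → ∃ m, MatchesOn H Set.univ m ∧ m a = b) :
    Expanding (blockRel H A F) := by
  classical
  rintro Y D ⟨a₀, ha₀⟩ ⟨a₁, ha₁⟩ hcl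
  have : Nonempty W := ⟨a₀.1⟩
  have hβ : ∀ m, MatchesOn H Set.univ m → ∃ β : {a // a ∈ A} → {k // k ∈ F},
      Function.Injective β ∧ ∀ a, m a.1 ∈ (β a).1 := by
    intro m hm
    obtain ⟨-, h1, -, h3⟩ := hB.matching_bijective hm
    choose! β hβ hβ' using h1
    refine ⟨fun a => ⟨β a.1, hβ a.1 a.2⟩, ?_, fun a => hβ' a.1 a.2⟩
    intro a b hab
    have hab : β a.1 = β b.1 := congrArg Subtype.val hab
    exact Subtype.ext (h3 a.1 a.2 b.1 b.2 (β a.1) (hβ a.1 a.2) (hβ' a.1 a.2)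
      (hab ▸ hβ' b.1 b.2))
  by_contra! hlt
  have hT1 : a₁.1 ∉ {w | (∃ a ∈ Y, a.1 = w) ∨ ∃ k ∈ D, w ∈ k.1} := by
    rintro (⟨a, ha, haa⟩ | ⟨k, -, hk⟩)
    · exact ha₁ (Subtype.ext haa ▸ ha)
    · exact Finset.disjoint_left.1 (hB.disjoint k.1 k.2) hk a₁.2
  obtain ⟨x, y, hxy, hx, hy⟩ := hH.exists_adj_mem_notMem
    (T := {w | (∃ a ∈ Y, a.1 = w) ∨ ∃ k ∈ D, w ∈ k.1}) (Or.inl ⟨a₀, ha₀, rfl⟩) hT1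
  obtain ⟨m, hm, rfl⟩ := hPM x y hxy
  obtain ⟨β, hβi, hβm⟩ := hβ m hm
  rcases hx with ⟨a, ha, rfl⟩ | ⟨k, hk, hx⟩
  · exact hy (Or.inr ⟨β a, hcl a ha _ ⟨_, hβm a, hxy⟩, hβm a⟩)
  · rcases hB.adj k.1 k.2 x hx _ hxy with h | h
    · exact hy (Or.inr ⟨k, hk, h⟩)
    · have hmaps : Set.MapsTo β Y D := fun a ha =>
        hcl a ha _ ⟨_, hβm a, (hm a.1 trivial).2.1⟩
      have hs := Finset.surjOn_of_injOn_of_card_le β hmaps hβi.injOn (by omega)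
      obtain ⟨a', ha', rfl⟩ := hs hk
      refine hy (Or.inl ⟨a', ha', ?_⟩)
      refine (hB.matching_bijective hm).2.2.2 a'.1 a'.2 (m x) h (β a').1 (β a').2 (hβm a') ?_
      rw [(hm x trivial).2.2]
      exact hx

/-- A system of distinct representatives for the blocks outside `Q` yields a matching. -/
theorem IsBarrier.exists_matchesOn_compl (hB : IsBarrier H A F)
    (hcov : ∀ w, w ∈ A ∨ ∃ k ∈ F, w ∈ k) (hAF : A.card = F.card)
    (hfc : ∀ k ∈ F, ∀ x ∈ k, ∃ m, MatchesOn H {w | w ∈ k ∧ w ≠ x} m)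
    (P : Finset {a // a ∈ A}) (Q : Finset {k // k ∈ F}) (hPQ : P.card = Q.card)
    (pt : {k // k ∈ F} → W) (hpt : ∀ k ∈ Q, pt k ∈ k.1)
    (hall : ∀ (Y : Finset {a // a ∈ A}) (D : Finset {k // k ∈ F}), (∀ a ∈ Y, a ∉ P) →
      (∀ a ∈ Y, ∀ k, blockRel H A F a k → k ∉ Q → k ∈ D) → Y.card ≤ D.card) :
    ∃ m, MatchesOn H {w | (∃ a ∈ P, a.1 = w) ∨ ∃ k ∈ Q, pt k = w}ᶜ m := by
  classical
  obtain ⟨φ, hφ, hr⟩ := (Fintype.all_card_le_filter_rel_iff_exists_injective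
    (fun (a : {a // a ∉ P}) (k : {k // k ∉ Q}) => blockRel H A F a.1 k.1)).1 <| by
    intro Y
    have := hall (Y.map (Function.Embedding.subtype _))
      ((Finset.univ.filter fun k : {k // k ∉ Q} => ∃ a ∈ Y, blockRel H A F a.1 k.1).map
        (Function.Embedding.subtype _)) (by simp +contextual) (by
          intro a ha k hak hk
          simp only [Finset.mem_map, Function.Embedding.subtype_apply] at ha ⊢
          obtain ⟨a', ha', rfl⟩ := ha
          exact ⟨⟨k, hk⟩, Finset.mem_filter.2 ⟨Finset.mem_univ _, a', ha', hak⟩, rfl⟩)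
    simpa using this
  have hcard : Fintype.card {a // a ∉ P} = Fintype.card {k // k ∉ Q} := by
    rw [Fintype.card_subtype_compl, Fintype.card_subtype_compl]
    simp [hPQ, hAF]
  have hφs : Function.Surjective φ :=
    ((Fintype.bijective_iff_injective_and_card φ).2 ⟨hφ, hcard⟩).2
  let S : {k // k ∈ F} → Set W := fun k =>
    {w | (w ∈ k.1 ∧ (k ∈ Q → w ≠ pt k)) ∨ ∃ a, (φ a).1 = k ∧ a.1.1 = w}
  have hd : Pairwise fun k l => Disjoint (S k) (S l) := by
    intro k l hkl
    have hkl' : k.1 ≠ l.1 := fun h => hkl (Subtype.ext h)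
    rw [Set.disjoint_left]
    rintro w (⟨hk, -⟩ | ⟨a, ha, rfl⟩) (⟨hl, -⟩ | ⟨b, hb, hbw⟩)
    · exact Finset.disjoint_left.1 (hB.pairwise k.1 k.2 l.1 l.2 hkl') hk hl
    · exact Finset.disjoint_left.1 (hB.disjoint k.1 k.2) hk (hbw ▸ b.1.2)
    · exact Finset.disjoint_left.1 (hB.disjoint l.1 l.2) hl a.1.2
    · have : b = a := Subtype.ext (Subtype.ext hbw)
      exact hkl (by rw [← ha, ← hb, this])
  have hS : ∀ k, ∃ m, MatchesOn H (S k) m := by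
    intro k
    by_cases hk : k ∈ Q
    · obtain ⟨m, hm⟩ := hfc k.1 k.2 (pt k) (hpt k hk)
      refine ⟨m, ?_⟩
      convert hm using 1
      ext w
      simp only [S, Set.mem_ofPred_eq]
      constructor
      · rintro (h | ⟨a, ha, -⟩)
        · exact ⟨h.1, h.2 hk⟩
        · exact ((φ a).2 (ha ▸ hk)).elim
      · exact fun h => Or.inl ⟨h.1, fun _ => h.2⟩
    · obtain ⟨a, ha⟩ := hφs ⟨k, hk⟩
      obtain ⟨x, hx, hax⟩ := hr a
      rw [ha] at hx
      obtain ⟨m, hm⟩ := hfc k.1 k.2 x hx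
      obtain ⟨m', hm', -⟩ := exists_matchesOn_pair hax
      obtain ⟨n, hn, -⟩ := hm.exists_union hm' (by
        rw [Set.disjoint_left]
        rintro w ⟨hw, hwx⟩ (rfl | rfl)
        · exact Finset.disjoint_left.1 (hB.disjoint k.1 k.2) hw a.1.2
        · exact hwx rfl)
      refine ⟨n, ?_⟩
      convert hn using 1
      ext w
      simp only [S, Set.mem_ofPred_eq, Set.mem_union, Set.mem_insert_iff, Set.mem_singleton_iff]
      constructor
      · rintro (h | ⟨b, hb, rfl⟩)
        · by_cases hwx : w = x
          · exact Or.inr (Or.inr hwx)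
          · exact Or.inl ⟨h.1, hwx⟩
        · have : b = a := hφ (Subtype.ext (hb.trans (congrArg Subtype.val ha).symm))
          exact Or.inr (Or.inl (by rw [this]))
      · rintro (h | rfl | rfl)
        · exact Or.inl ⟨h.1, fun h' => (hk h').elim⟩
        · exact Or.inr ⟨a, congrArg Subtype.val ha, rfl⟩
        · exact Or.inl ⟨hx, fun h' => (hk h').elim⟩
  obtain ⟨m, hm⟩ := exists_matchesOn_iUnion hd hS
  refine ⟨m, ?_⟩
  convert hm using 1
  ext w
  simp only [Set.mem_compl_iff, Set.mem_ofPred_eq, Set.mem_iUnion, S]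
  constructor
  · intro hw
    push Not at hw
    rcases hcov w with h | ⟨k, hk, h⟩
    · have hP : (⟨w, h⟩ : {a // a ∈ A}) ∉ P := fun h' => hw.1 _ h' rfl
      exact ⟨_, Or.inr ⟨⟨⟨w, h⟩, hP⟩, rfl, rfl⟩⟩
    · exact ⟨⟨k, hk⟩, Or.inl ⟨h, fun h' h'' => hw.2 _ h' h''.symm⟩⟩
  · rintro ⟨k, ⟨hk, hkQ⟩ | ⟨a, -, rfl⟩⟩ (⟨b, hb, hbw⟩ | ⟨l, hl, hlw⟩)
    · exact Finset.disjoint_left.1 (hB.disjoint k.1 k.2) hk (hbw ▸ b.2)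
    · by_cases hkl : k = l
      · subst hkl
        exact hkQ hl hlw.symm
      · exact Finset.disjoint_left.1
          (hB.pairwise k.1 k.2 l.1 l.2 fun h => hkl (Subtype.ext h)) hk (hlw ▸ hpt l hl)
    · exact a.2 (Subtype.ext hbw ▸ hb)
    · exact Finset.disjoint_left.1 (hB.disjoint l.1 l.2) (hpt l hl) (hlw ▸ a.1.2)

end Barriers

section TwoEars

variable {W : Type*} {H : SimpleGraph W}

/-- In a matching covered graph, a perfect matching off `U` together with a pairing of `U` yields
one or two pairs whose removal leaves a perfect matching. -/
theorem exists_matchesOn_compl_pairs [Fintype W] (hH : H.Connected)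
    (hPM : ∀ a b, H.Adj a b → ∃ m, MatchesOn H Set.univ m ∧ m a = b) {U : Set W}
    (hU : U.Nonempty) {σ : W → W} (hσ : ∀ u ∈ U, σ u ∈ U ∧ σ u ≠ u ∧ σ (σ u) = u) {n : W → W}
    (hn : MatchesOn H Uᶜ n) :
    (∃ u ∈ U, ∃ m, MatchesOn H {u, σ u}ᶜ m) ∨
      ∃ u ∈ U, ∃ u' ∈ U, u' ≠ u ∧ u' ≠ σ u ∧ ∃ m, MatchesOn H {u, σ u, u', σ u'}ᶜ m := by
  classical
  by_contra! hcon
  obtain ⟨h1, h2⟩ := hcon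
  obtain ⟨u₀, hu₀⟩ := hU
  have heven : Even (Fintype.card W) := by
    obtain ⟨x, y, hxy, -⟩ := hH.exists_adj_mem_notMem (T := {u₀}) rfl (hσ u₀ hu₀).2.1
    obtain ⟨m, hm, -⟩ := hPM x y hxy
    exact MatchesOn.even_card (S := Finset.univ) (by simpa using hm)
  obtain ⟨A₀, F₀, hB₀, hA₀, -⟩ := exists_isBarrier_of_not_matchesOn heven (hσ u₀ hu₀).2.1.symm
    (H := H) (by simpa using h1 u₀ hu₀)
  obtain ⟨A, ⟨huA, F, hB⟩, hmax⟩ := Set.exists_max_image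
    {A : Finset W | u₀ ∈ A ∧ ∃ F, IsBarrier H A F} Finset.card (Set.toFinite _) ⟨A₀, hA₀, F₀, hB₀⟩
  have hfc : ∀ k ∈ F, ∀ x ∈ k, ∃ m, MatchesOn H {w | w ∈ k ∧ w ≠ x} m := by
    intro k hk x hx
    obtain ⟨m, hm⟩ := hB.exists_matchesOn_erase
      (fun A' F' hB' hAA' => hmax A' ⟨hAA' huA, F', hB'⟩) hk hx
    refine ⟨m, ?_⟩
    convert hm using 1
    ext w
    simp [and_comm]
  have hcov := hB.mem_or_mem hH hPM ⟨u₀, huA⟩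
  have hind : ∀ {a b}, a ∈ A → b ∈ A → ¬ H.Adj a b := hB.not_adj hPM
  have hexp := hB.expanding hH hPM
  have : Nonempty W := ⟨u₀⟩
  have hAF : A.card = F.card := by
    obtain ⟨x, y, hxy, -⟩ := hH.exists_adj_mem_notMem (T := {u₀}) rfl (hσ u₀ hu₀).2.1
    obtain ⟨m, hm, -⟩ := hPM x y hxy
    exact (hB.matching_bijective hm).1
  have hkA : ∀ {k w}, k ∈ F → w ∈ k → w ∉ A := fun hk hw =>
    Finset.disjoint_left.1 (hB.disjoint _ hk) hw
  have hkk : ∀ {k l : {k // k ∈ F}} {w}, w ∈ k.1 → w ∈ l.1 → k = l := by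
    intro k l w hk hl
    by_contra hne
    exact Finset.disjoint_left.1
      (hB.pairwise k.1 k.2 l.1 l.2 fun h => hne (Subtype.ext h)) hk hl
  have hsingle : ∀ x ∈ A, ∀ k ∈ F, ∀ y ∈ k, ∃ m, MatchesOn H {x, y}ᶜ m := by
    intro x hx k hk y hy
    obtain ⟨m, hm⟩ := hB.exists_matchesOn_compl hcov hAF hfc {⟨x, hx⟩} {⟨k, hk⟩} rfl
      (fun _ => y) (by simpa using hy) <| by
        intro Y D hY hD
        rcases Y.eq_empty_or_nonempty with rfl | hne
        · simp
        have := hexp Y (insert ⟨k, hk⟩ D) hne ⟨⟨x, hx⟩, fun h => hY _ h (by simp)⟩ <| by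
          intro a ha l hal
          by_cases hl : l = ⟨k, hk⟩
          · simp [hl]
          · exact Finset.mem_insert_of_mem (hD a ha l hal (by simpa using hl))
        have := Finset.card_insert_le (⟨k, hk⟩ : {k // k ∈ F}) D
        omega
    refine ⟨m, ?_⟩
    convert hm using 2
    ext w
    simp [eq_comm]
  have hσA : ∀ u ∈ U, u ∈ A → σ u ∈ A := by
    intro u hu hA
    rcases hcov (σ u) with h | ⟨k, hk, h⟩
    · exact h
    · obtain ⟨m, hm⟩ := hsingle u hA k hk _ h
      exact (h1 u hu m hm).elim
  have hσk : ∀ u ∈ U, ∀ k ∈ F, u ∈ k → ∃ l : {k // k ∈ F}, σ u ∈ l.1 := by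
    intro u hu k hk huk
    rcases hcov (σ u) with h | ⟨k, hk, h⟩
    · exact (hkA hk huk ((hσ u hu).2.2 ▸ hσA _ (hσ u hu).1 h)).elim
    · exact ⟨⟨k, hk⟩, h⟩
  let σ' : {a // a ∈ A} → {a // a ∈ A} := fun a => if h : σ a.1 ∈ A then ⟨σ a.1, h⟩ else a
  have hσ' : ∀ a : {a // a ∈ A}, a.1 ∈ U → (σ' a).1 = σ a.1 := by
    intro a ha
    simp only [σ', dif_pos (hσA a.1 ha a.2)]
  have hν : ∀ a : {a // a ∈ A}, ∃ k : {k // k ∈ F}, a.1 ∉ U → n a.1 ∈ k.1 := by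
    intro a
    by_cases ha : a.1 ∈ U
    · obtain ⟨k, hk⟩ := Finset.card_pos.1 (hAF ▸ Finset.card_pos.2 ⟨u₀, huA⟩)
      exact ⟨⟨k, hk⟩, fun h => (h ha).elim⟩
    · rcases hcov (n a.1) with h | ⟨k, hk, h⟩
      · exact (hind a.2 h (hn a.1 ha).2.1).elim
      · exact ⟨⟨k, hk⟩, fun _ => h⟩
  choose ν hν using hν
  obtain ⟨a, haU, k, k', ⟨x, hxU, hxk, hxk'⟩, hlink⟩ := exists_not_linked_pair hexp
    (by simpa using hAF) (O := {a | a.1 ∈ U}) ⟨⟨u₀, huA⟩, hu₀⟩ (σ := σ')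
    (fun a ha => ⟨by simpa [hσ' a ha] using (hσ _ ha).1, fun h => (hσ _ ha).2.1 <| by
      rw [← hσ' a ha, h]⟩)
    (q := fun k k' => ∃ x ∈ U, x ∈ k.1 ∧ σ x ∈ k'.1) (ν := ν)
    (fun a ha => ⟨n a.1, hν a ha, (hn a.1 ha).2.1⟩) <| by
      intro D hD
      set S : Finset W := D.biUnion Subtype.val with hS
      have memS : ∀ {w}, w ∈ S ↔ ∃ k ∈ D, w ∈ k.1 := by simp [hS]
      have hSD : Even S.card ↔ Even D.card := by
        rw [← Nat.not_odd_iff_even, ← Nat.not_odd_iff_even, not_iff_not, hS,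
          Finset.card_biUnion fun k _ l _ hkl =>
            hB.pairwise k.1 k.2 l.1 l.2 fun h => hkl (Subtype.ext h),
          Finset.odd_sum_iff_odd_card_odd,
          Finset.filter_true_of_mem fun k _ => hB.odd k.1 k.2]
      have c1 : Even (S.filter (· ∈ U)).card := by
        refine even_card_of_involution _ σ fun w hw => ?_
        obtain ⟨hwS, hwU⟩ := Finset.mem_filter.1 hw
        obtain ⟨k, hk, hwk⟩ := memS.1 hwS
        obtain ⟨l, hl⟩ := hσk w hwU k.1 k.2 hwk
        exact ⟨Finset.mem_filter.2 ⟨memS.2 ⟨l, hD k hk l ⟨w, hwU, hwk, hl⟩, hl⟩, (hσ w hwU).1⟩,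
          (hσ w hwU).2⟩
      have c2 : Even ((S.filter (· ∉ U)).filter (n · ∈ S)).card := by
        refine even_card_of_involution _ n fun w hw => ?_
        simp only [Finset.mem_filter] at hw ⊢
        obtain ⟨h1, h2, h3⟩ := hn w hw.1.2
        exact ⟨⟨⟨hw.2, h1⟩, h3.symm ▸ hw.1.1⟩, h2.ne', h3⟩
      have c3 : (Finset.univ.filter fun a : {a // a ∈ A} => a ∉ {a | a.1 ∈ U} ∧ ν a ∈ D).card =
          ((S.filter (· ∉ U)).filter (n · ∉ S)).card := by
        refine Finset.card_bij (fun a _ => n a.1) ?_ ?_ ?_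
        · intro a ha
          obtain ⟨-, haU, haD⟩ := Finset.mem_filter.1 ha
          obtain ⟨h1, -, h3⟩ := hn a.1 haU
          simp only [Finset.mem_filter, h3]
          refine ⟨⟨memS.2 ⟨ν a, haD, hν a haU⟩, h1⟩, fun h => ?_⟩
          obtain ⟨k, -, hk⟩ := memS.1 h
          exact hkA k.2 hk a.2
        · intro a ha b hb hab
          obtain ⟨-, haU, -⟩ := Finset.mem_filter.1 ha
          obtain ⟨-, hbU, -⟩ := Finset.mem_filter.1 hb
          exact Subtype.ext (by rw [← (hn a.1 haU).2.2, ← (hn b.1 hbU).2.2, hab])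
        · intro w hw
          simp only [Finset.mem_filter] at hw
          obtain ⟨⟨hwS, hwU⟩, hnS⟩ := hw
          obtain ⟨k, hk, hwk⟩ := memS.1 hwS
          obtain ⟨h1, h2, h3⟩ := hn w hwU
          have hA : n w ∈ A := (hB.adj k.1 k.2 w hwk _ h2).resolve_left
            fun h => hnS (memS.2 ⟨k, hk, h⟩)
          have hνk := hν ⟨n w, hA⟩ h1
          simp only [h3] at hνk
          exact ⟨⟨n w, hA⟩,
            Finset.mem_filter.2 ⟨Finset.mem_univ _, h1, by rw [hkk hνk hwk]; exact hk⟩, h3⟩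
      have e1 := Finset.card_filter_add_card_filter_not (s := S) (· ∈ U)
      have e2 := Finset.card_filter_add_card_filter_not (s := S.filter (· ∉ U)) (n · ∈ S)
      rw [← hSD]
      grind
  have hne : k ≠ k' := by
    rintro rfl
    exact hlink (Linked.refl _ _)
  have hσa := hσ' a haU
  have hxA : x ∉ A := hkA k.2 hxk
  have haa : a ≠ σ' a := fun h => (hσ _ haU).2.1 (by rw [← hσa, ← h])
  obtain ⟨m, hm⟩ := hB.exists_matchesOn_compl hcov hAF hfc {a, σ' a} {k, k'}
    (by rw [Finset.card_pair haa, Finset.card_pair hne])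
    (fun l => if l = k then x else σ x) (by simp [hxk, hxk', hne.symm]) <| by
      intro Y D hY hD
      rcases Y.eq_empty_or_nonempty with rfl | hYne
      · simp
      by_contra! hlt
      have hcl : ∀ b ∈ Y, ∀ l, blockRel H A F b l → l ∈ insert k (insert k' D) := by
        intro b hb l hbl
        by_cases hl : l ∈ ({k, k'} : Finset {k // k ∈ F})
        · simp only [Finset.mem_insert, Finset.mem_singleton] at hl ⊢
          tauto
        · simp [hD b hb l hbl hl]
      have e := hexp Y _ hYne ⟨a, fun h => hY _ h (by simp)⟩ hcl
      have e1 := Finset.card_insert_le k (insert k' D)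
      have e2 := Finset.card_insert_le k' D
      refine hlink ⟨Y, insert k (insert k' D), ⟨hcl, by omega⟩, ?_, by simp, by simp⟩
      intro b hb
      simpa using hY b hb
  refine h2 a.1 haU x hxU (fun h => hxA (h ▸ a.2)) (fun h => hxA (h ▸ hσa ▸ (σ' a).2)) m ?_
  convert hm using 2
  ext w
  simp [hne, hσa, eq_comm, or_assoc]

end TwoEars

/-- Every edge of the subgraph `H` lies in a perfect matching of `H`. -/
def EdgesMatched {V : Type*} {G : SimpleGraph V} (H : G.Subgraph) : Prop :=
  ∀ a b, H.Adj a b → ∃ m, MatchesOn H.spanningCoe H.verts m ∧ m a = b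

/-- The edges of `R` are covered by a perfect matching of `R` and one of `R - E`. -/
def IsEarLike {V : Type*} {G : SimpleGraph V} (R : G.Subgraph) (E : Set V) : Prop :=
  ∃ m₁ m₂, MatchesOn R.spanningCoe R.verts m₁ ∧ MatchesOn R.spanningCoe (R.verts \ E) m₂ ∧
    ∀ a b, R.Adj a b → m₁ a = b ∨ a ∉ E ∧ m₂ a = b

section Coverings

variable {V : Type*} {G : SimpleGraph V}

theorem MatchingCovered.exists_matchesOn (h : MatchingCovered G) {a b : V} (hab : G.Adj a b) :
    ∃ m, MatchesOn G Set.univ m ∧ m a = b := by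
  obtain ⟨M, hM, he⟩ := h.2.2 s(a, b) hab
  obtain ⟨m, hm, hm'⟩ := hM.1.exists_matchesOn
  rw [Subgraph.isSpanning_iff.1 hM.2] at hm
  exact ⟨m, hm, hm' a b he⟩

theorem MatchesOn.exists_perfectMatching {m : V → V} (h : MatchesOn G Set.univ m) (a : V) :
    ∃ M : G.Subgraph, M.IsPerfectMatching ∧ s(a, m a) ∈ M.edgeSet := by
  obtain ⟨M, h1, h2, h3⟩ := h.exists_isMatching
  exact ⟨M, ⟨h1, Subgraph.isSpanning_iff.2 h2⟩, h3 a trivial⟩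

theorem MatchesOn.of_coe {H : G.Subgraph} {S : Set H.verts} {m : H.verts → H.verts}
    (h : MatchesOn H.coe S m) :
    ∃ m', MatchesOn H.spanningCoe (Subtype.val '' S) m' ∧ ∀ a, m' a.1 = (m a).1 := by
  classical
  let m' : V → V := fun w => if hw : w ∈ H.verts then m ⟨w, hw⟩ else w
  have hm' : ∀ a : H.verts, m' a.1 = (m a).1 := fun a => by simp only [m', dif_pos a.2]
  refine ⟨m', ?_, hm'⟩
  rintro _ ⟨a, ha, rfl⟩
  obtain ⟨h1, h2, h3⟩ := h a ha
  rw [hm', hm', h3]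
  exact ⟨⟨_, h1, rfl⟩, h2, rfl⟩

theorem MatchesOn.to_coe {H : G.Subgraph} {T : Set V} {m : V → V}
    (h : MatchesOn H.spanningCoe T m) :
    ∃ m', MatchesOn H.coe (Subtype.val ⁻¹' T) m' ∧ ∀ a : H.verts, a.1 ∈ T → (m' a).1 = m a.1 := by
  classical
  let m' : H.verts → H.verts := fun a => if ha : m a.1 ∈ H.verts then ⟨m a.1, ha⟩ else a
  have hm' : ∀ a : H.verts, a.1 ∈ T → (m' a).1 = m a.1 := by
    intro a ha
    have hv : m a.1 ∈ H.verts := H.edge_vert (H.symm.symm _ _ (h a.1 ha).2.1)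
    simp only [m', dif_pos hv]
  refine ⟨m', ?_, hm'⟩
  intro a ha
  obtain ⟨h1, h2, h3⟩ := h a.1 ha
  rw [← hm' a ha] at h1 h2 h3
  exact ⟨h1, h2, Subtype.ext ((hm' _ h1).trans h3)⟩

theorem matchingCovered_coe_iff {H : G.Subgraph} :
    MatchingCovered H.coe ↔ H.Connected ∧ H.verts.Nontrivial ∧ EdgesMatched H := by
  constructor
  · intro h
    refine ⟨⟨h.1⟩, Set.nontrivial_coe_sort.1 h.2.1, fun a b hab => ?_⟩
    have hab' : H.coe.Adj ⟨a, H.edge_vert hab⟩ ⟨b, H.edge_vert hab.symm⟩ := hab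
    obtain ⟨m, hm, hmab⟩ := h.exists_matchesOn hab'
    obtain ⟨m', hm', he⟩ := hm.of_coe
    refine ⟨m', by simpa using hm', ?_⟩
    rw [he ⟨a, H.edge_vert hab⟩, hmab]
  · rintro ⟨h1, h2, h3⟩
    refine ⟨h1.coe, Set.nontrivial_coe_sort.2 h2, fun e he => ?_⟩
    induction e with
    | _ a b =>
      obtain ⟨m, hm, hmab⟩ := h3 a.1 b.1 he
      obtain ⟨m', hm', he⟩ := hm.to_coe
      have : m' a = b := Subtype.ext ((he a a.2).trans hmab)
      rw [← this]
      refine MatchesOn.exists_perfectMatching ?_ a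
      simpa using hm'

theorem EdgesMatched.exists_matchesOn {H : G.Subgraph} (h : EdgesMatched H) (hc : H.Connected)
    (hn : H.verts.Nontrivial) : ∃ m, MatchesOn H.spanningCoe H.verts m := by
  obtain ⟨a, ha, b, hb, hab⟩ := hn
  obtain ⟨x, y, hxy, -⟩ := hc.coe.exists_adj_mem_notMem (T := {⟨a, ha⟩}) (a := ⟨a, ha⟩)
    (b := ⟨b, hb⟩) rfl fun h => hab (congrArg Subtype.val h).symm
  obtain ⟨m, hm, -⟩ := h x.1 y.1 hxy
  exact ⟨m, hm⟩

theorem EdgesMatched.sup {H R : G.Subgraph} {E : Set V} (hH : EdgesMatched H)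
    (hH' : ∃ m, MatchesOn H.spanningCoe H.verts m) (hR : IsEarLike R E)
    (hE : R.verts ∩ H.verts = E) (hHE : ∃ m, MatchesOn H.spanningCoe (H.verts \ E) m) :
    EdgesMatched (H ⊔ R) := by
  obtain ⟨m₁, m₂, h1, h2, h12⟩ := hR
  have le1 : H.spanningCoe ≤ (H ⊔ R).spanningCoe := fun a b h => Or.inl h
  have le2 : R.spanningCoe ≤ (H ⊔ R).spanningCoe := fun a b h => Or.inr h
  have d2 : Disjoint H.verts (R.verts \ E) := by
    rw [Set.disjoint_left, ← hE]
    rintro w hw ⟨hw1, hw2⟩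
    exact hw2 ⟨hw1, hw⟩
  have d1 : Disjoint (H.verts \ E) R.verts := by
    rw [Set.disjoint_left, ← hE]
    rintro w ⟨hw1, hw2⟩ hw
    exact hw2 ⟨hw, hw1⟩
  have u2 : H.verts ∪ R.verts \ E = (H ⊔ R).verts := by
    ext w
    simp only [← hE, Subgraph.verts_sup, Set.mem_union, Set.mem_sdiff, Set.mem_inter_iff]
    tauto
  have u1 : H.verts \ E ∪ R.verts = (H ⊔ R).verts := by
    ext w
    simp only [← hE, Subgraph.verts_sup, Set.mem_union, Set.mem_sdiff, Set.mem_inter_iff]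
    tauto
  rintro a b (hab | hab)
  · obtain ⟨m, hm, rfl⟩ := hH a b hab
    obtain ⟨n, hn, e, -⟩ := (hm.mono le1).exists_union (h2.mono le2) d2
    exact ⟨n, u2 ▸ hn, e (H.edge_vert hab)⟩
  · rcases h12 a b hab with rfl | ⟨haE, rfl⟩
    · obtain ⟨m, hm⟩ := hHE
      obtain ⟨n, hn, -, e⟩ := (hm.mono le1).exists_union (h1.mono le2) d1
      exact ⟨n, u1 ▸ hn, e (R.edge_vert hab)⟩
    · obtain ⟨m, hm⟩ := hH'
      obtain ⟨n, hn, -, e⟩ := (hm.mono le1).exists_union (h2.mono le2) d2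
      exact ⟨n, u2 ▸ hn, e ⟨R.edge_vert hab, haE⟩⟩

theorem IsEarLike.sup {R R' : G.Subgraph} {E E' : Set V} (hR : IsEarLike R E)
    (hR' : IsEarLike R' E') (hd : Disjoint R.verts R'.verts) (hE : E ⊆ R.verts)
    (hE' : E' ⊆ R'.verts) : IsEarLike (R ⊔ R') (E ∪ E') := by
  obtain ⟨m₁, m₂, h1, h2, h12⟩ := hR
  obtain ⟨m₁', m₂', h1', h2', h12'⟩ := hR'
  have le1 : R.spanningCoe ≤ (R ⊔ R').spanningCoe := fun a b h => Or.inl h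
  have le2 : R'.spanningCoe ≤ (R ⊔ R').spanningCoe := fun a b h => Or.inr h
  have hd' := Set.disjoint_left.1 hd
  obtain ⟨n₁, hn₁, e₁, e₁'⟩ := (h1.mono le1).exists_union (h1'.mono le2) hd
  obtain ⟨n₂, hn₂, e₂, e₂'⟩ := (h2.mono le1).exists_union (h2'.mono le2)
    (hd.mono Set.sdiff_subset Set.sdiff_subset)
  refine ⟨n₁, n₂, hn₁, ?_, ?_⟩
  · convert hn₂ using 1
    ext w
    simp only [Subgraph.verts_sup, Set.mem_sdiff, Set.mem_union]
    have := @hE w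
    have := @hE' w
    have := @hd' w
    tauto
  · rintro a b (hab | hab)
    · have ha := R.edge_vert hab
      rcases h12 a b hab with h | ⟨haE, h⟩
      · exact Or.inl ((e₁ ha).trans h)
      · exact Or.inr ⟨fun h' => h'.elim haE fun h' => hd' ha (hE' h'), (e₂ ⟨ha, haE⟩).trans h⟩
    · have ha := R'.edge_vert hab
      rcases h12' a b hab with h | ⟨haE, h⟩
      · exact Or.inl ((e₁' ha).trans h)
      · exact Or.inr ⟨fun h' => h'.elim (fun h' => hd' (hE h') ha) haE,
          (e₂' ⟨ha, haE⟩).trans h⟩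

theorem isEarLike_subgraphOfAdj {x y : V} (h : G.Adj x y) :
    IsEarLike (G.subgraphOfAdj h) {x, y} := by
  have hxy : (G.subgraphOfAdj h).spanningCoe.Adj x y := by simp [h.ne]
  obtain ⟨m, hm, h1, h2⟩ := exists_matchesOn_pair hxy
  refine ⟨m, m, hm, ?_, ?_⟩
  · rw [subgraphOfAdj_verts, Set.sdiff_self]
    exact matchesOn_empty m
  · intro a b hab
    simp only [subgraphOfAdj_adj, Sym2.eq_iff] at hab
    rcases hab with ⟨rfl, rfl⟩ | ⟨rfl, rfl⟩
    · exact Or.inl h1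
    · exact Or.inl h2

theorem SimpleGraph.Walk.IsPath.isEarLike {x y : V} {P : G.Walk x y} (hP : P.IsPath)
    (hodd : Odd P.length) : IsEarLike P.toSubgraph {x, y} := by
  match P, hP, hodd with
  | .cons h .nil, _, _ =>
    simpa [Walk.toSubgraph] using isEarLike_subgraphOfAdj h
  | .cons (v := w) h (.cons (v := z) h' q), hP, hodd =>
    simp only [Walk.cons_isPath_iff, Walk.support_cons, List.mem_cons, not_or] at hP
    obtain ⟨⟨hq, hwq⟩, hxw, hxq⟩ := hP
    have hqo : Odd q.length := by
      simp only [Walk.length_cons] at hodd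
      grind
    have hzy : z ≠ y := by
      rintro rfl
      rw [Walk.length_eq_zero_iff.2 (Walk.isPath_iff_nil.1 hq)] at hqo
      simp at hqo
    have ih := hq.isEarLike hqo
    obtain ⟨m₁, m₂, h1, h2, h12⟩ := ih
    set R := (Walk.cons h (Walk.cons h' q)).toSubgraph with hR
    have le : q.toSubgraph.spanningCoe ≤ R.spanningCoe := by
      intro a b hab
      exact Or.inr (Or.inr hab)
    have hzq : z ∈ q.support := q.start_mem_support
    have hyq : y ∈ q.support := q.end_mem_support
    have axw : R.spanningCoe.Adj x w := Or.inl (by simp)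
    have awz : R.spanningCoe.Adj w z := Or.inr (Or.inl (by simp))
    obtain ⟨n₁, hn₁, ex, ew⟩ := exists_matchesOn_pair axw
    obtain ⟨n₂, hn₂, ew', ez⟩ := exists_matchesOn_pair awz
    obtain ⟨k₁, hk₁, a₁, b₁⟩ := hn₁.exists_union (h1.mono le) (by
      rw [Set.disjoint_left]
      rintro v (rfl | rfl) hv
      · exact hxq ((Walk.mem_verts_toSubgraph _).1 hv)
      · exact hwq ((Walk.mem_verts_toSubgraph _).1 hv))
    obtain ⟨k₂, hk₂, a₂, b₂⟩ := hn₂.exists_union (h2.mono le) (by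
      rw [Set.disjoint_left]
      rintro v (rfl | rfl) ⟨hv, hv'⟩
      · exact hwq ((Walk.mem_verts_toSubgraph _).1 hv)
      · exact hv' (Or.inl rfl))
    refine ⟨k₁, k₂, ?_, ?_, ?_⟩
    · convert hk₁ using 1
      ext v
      simp only [hR, Walk.verts_toSubgraph, Walk.support_cons, List.mem_cons,
        Set.mem_ofPred_eq, Set.mem_insert_iff, Set.mem_singleton_iff, Set.mem_union]
      grind
    · convert hk₂ using 1
      ext v
      simp only [hR, Walk.verts_toSubgraph, Walk.support_cons, List.mem_cons, Set.mem_sdiff,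
        Set.mem_ofPred_eq, Set.mem_insert_iff, Set.mem_singleton_iff, Set.mem_union]
      grind
    · intro a b hab
      have hab : (G.subgraphOfAdj h).Adj a b ∨ (G.subgraphOfAdj h').Adj a b ∨
        q.toSubgraph.Adj a b := hab
      simp only [subgraphOfAdj_adj, Sym2.eq_iff] at hab
      rcases hab with (⟨rfl, rfl⟩ | ⟨rfl, rfl⟩) | (⟨rfl, rfl⟩ | ⟨rfl, rfl⟩) | hab
      · exact Or.inl ((a₁ (by simp)).trans ex)
      · exact Or.inl ((a₁ (by simp)).trans ew)
      · refine Or.inr ⟨?_, (a₂ (by simp)).trans ew'⟩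
        rintro (rfl | rfl)
        · exact hxw rfl
        · exact hwq hyq
      · refine Or.inr ⟨?_, (a₂ (by simp)).trans ez⟩
        rintro (rfl | rfl)
        · exact hxq hzq
        · exact hzy rfl
      · have ha := q.toSubgraph.edge_vert hab
        have ha' := (Walk.mem_verts_toSubgraph _).1 ha
        rcases h12 a b hab with e | ⟨haE, e⟩
        · exact Or.inl ((b₁ ha).trans e)
        · refine Or.inr ⟨?_, (b₂ ⟨ha, haE⟩).trans e⟩
          rintro (rfl | rfl)
          · exact hxq ha'
          · exact haE (Or.inr rfl)
termination_by P.length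

theorem SimpleGraph.Walk.IsCycle.matchingCovered {u : V} {C : G.Walk u u} (hC : C.IsCycle)
    (heven : Even C.length) : MatchingCovered C.toSubgraph.coe := by
  match C, hC, heven with
  | .cons (v := v) h p, hC, heven =>
    obtain ⟨hp, -⟩ := Walk.cons_isCycle_iff p h |>.1 hC
    have hpo : Odd p.length := by
      simp only [Walk.length_cons] at heven
      grind
    rw [matchingCovered_coe_iff]
    refine ⟨Walk.toSubgraph_connected _, ⟨u, by simp, v, by simp, h.ne⟩, ?_⟩
    obtain ⟨m, m', hm, -, hm'⟩ := isEarLike_subgraphOfAdj h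
    refine EdgesMatched.sup (E := {u, v}) ?_ ⟨m, hm⟩ (Set.pair_comm v u ▸ hp.isEarLike hpo) ?_ ?_
    · intro a b hab
      exact ⟨m, hm, (hm' a b hab).resolve_right fun h' =>
        h'.1 ((G.subgraphOfAdj h).edge_vert hab)⟩
    · ext w
      simp only [Walk.verts_toSubgraph, subgraphOfAdj_verts, Set.mem_inter_iff]
      refine ⟨fun h => h.2, fun h => ⟨?_, h⟩⟩
      rcases h with rfl | rfl
      · exact p.end_mem_support
      · exact p.start_mem_support
    · rw [subgraphOfAdj_verts, Set.sdiff_self]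
      exact ⟨m, matchesOn_empty m⟩

end Coverings

section Ears

variable {V : Type*} {G : SimpleGraph V}

theorem exists_isPath_zigzag {H : G.Subgraph} {n : ℕ} {z : ℤ → V}
    (hinj : ∀ a b : ℤ, -n < a → a ≤ n → -n < b → b ≤ n → z a = z b → a = b)
    (hmem : ∀ k : ℤ, -n < k → k ≤ n → z k ∈ H.verts → k = 0 ∨ k = n)
    (hν : ∀ k, G.Adj (z k) (z (1 - k))) (hμ : ∀ k, z k ∉ H.verts → G.Adj (z k) (z (-k)))
    (h01 : ¬ H.Adj (z 0) (z 1)) (j : ℕ) (hj : j < n) :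
    ∃ P : G.Walk (z 0) (z (j + 1)), P.IsPath ∧ Odd P.length ∧
      (∀ w, w ∈ P.support ↔ ∃ k : ℤ, -j ≤ k ∧ k ≤ j + 1 ∧ z k = w) ∧
      ∀ e ∈ P.edges, e ∉ H.edgeSet := by
  induction j with
  | zero =>
    have h : G.Adj (z 0) (z ((0 : ℕ) + 1)) := by simpa using hν 0
    refine ⟨.cons h .nil, by simpa using h.ne, by simp, fun w => ?_, ?_⟩
    · simp only [Walk.support_cons, Walk.support_nil, List.mem_cons, List.not_mem_nil, or_false]
      constructor
      · rintro (rfl | rfl)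
        · exact ⟨0, by simp⟩
        · exact ⟨1, by simp⟩
      · rintro ⟨k, h1, h2, rfl⟩
        have : k = 0 ∨ k = 1 := by push_cast at h1 h2; omega
        rcases this with rfl | rfl
        · exact Or.inl rfl
        · exact Or.inr (by simp)
    · simpa using h01
  | succ j ih =>
    obtain ⟨P, hP, hodd, hsupp, hedge⟩ := ih (by omega)
    have hout : ∀ k : ℤ, -n < k → k < n → k ≠ 0 → z k ∉ H.verts := by
      intro k h1 h2 h0 hk
      rcases hmem k h1 h2.le hk with h | h <;> omega
    have o1 : z (j + 1) ∉ H.verts := hout _ (by omega) (by omega) (by omega)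
    have o2 : z (-(j + 1)) ∉ H.verts := hout _ (by omega) (by omega) (by omega)
    have a1 : G.Adj (z (j + 1)) (z (-(j + 1))) := hμ _ o1
    have a2 : G.Adj (z (-(j + 1))) (z ((j + 1 : ℕ) + 1)) := by
      have := hν (-(j + 1))
      rwa [show (1 : ℤ) - -(j + 1) = (j + 1 : ℕ) + 1 by push_cast; ring] at this
    have n1 : z (-(j + 1)) ∉ P.support := by
      rw [hsupp]
      rintro ⟨k, h1, h2, h⟩
      have := hinj k _ (by omega) (by omega) (by omega) (by omega) h
      omega
    have n2 : z ((j + 1 : ℕ) + 1) ∉ (P.concat a1).support := by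
      rw [Walk.support_concat, List.mem_append, hsupp, List.mem_singleton]
      rintro (⟨k, h1, h2, h⟩ | h)
      · have := hinj k _ (by omega) (by omega) (by push_cast; omega) (by push_cast; omega) h
        push_cast at this
        omega
      · have := hinj _ _ (by push_cast; omega) (by push_cast; omega) (by omega) (by omega) h
        push_cast at this
        omega
    refine ⟨(P.concat a1).concat a2, (hP.concat n1 a1).concat n2 a2, ?_, fun w => ?_, ?_⟩
    · rw [Walk.length_concat, Walk.length_concat]
      grind
    · rw [Walk.support_concat, Walk.support_concat, List.mem_append, List.mem_append, hsupp,
        List.mem_singleton, List.mem_singleton]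
      constructor
      · rintro ((⟨k, h1, h2, h⟩ | rfl) | rfl)
        · exact ⟨k, by push_cast; omega, by push_cast; omega, h⟩
        · exact ⟨_, by push_cast; omega, by push_cast; omega, rfl⟩
        · exact ⟨_, by push_cast; omega, by push_cast; omega, rfl⟩
      · rintro ⟨k, h1, h2, rfl⟩
        by_cases e1 : k = -(j + 1)
        · exact Or.inl (Or.inr (by rw [e1]))
        by_cases e2 : k = (j + 1 : ℕ) + 1
        · exact Or.inr (by rw [e2])
        exact Or.inl (Or.inl ⟨k, by push_cast at *; omega, by push_cast at *; omega, rfl⟩)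
    · intro e he
      rw [Walk.edges_concat, Walk.edges_concat, List.concat_eq_append, List.concat_eq_append,
        List.mem_append, List.mem_append, List.mem_singleton, List.mem_singleton] at he
      rcases he with (he | rfl) | rfl
      · exact hedge e he
      · exact fun h => o1 (H.edge_vert h)
      · exact fun h => o2 (H.edge_vert h)

/-- The orbit of `u` under the permutation alternating between two matchings is an ear. -/
theorem exists_ear [Finite V] {H : G.Subgraph} {μ ν : V → V} {τ : Equiv.Perm V}
    (hμH : ∀ w ∈ H.verts, μ w = w) (hμ : ∀ w ∉ H.verts, G.Adj w (μ w)) (hμμ : ∀ w, μ (μ w) = w)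
    (hν : ∀ w, G.Adj w (ν w)) (hνν : ∀ w, ν (ν w) = w) (hτ : ∀ w, τ w = ν (μ w)) {u : V}
    (hu : u ∈ H.verts) (huν : ¬ H.Adj u (ν u)) :
    ∃ v ∈ H.verts, ¬ H.Adj v (ν v) ∧ v ≠ u ∧ τ.SameCycle u v ∧
      (∀ w ∈ H.verts, τ.SameCycle u w → w = u ∨ w = v) ∧
      ∃ P : G.Walk u v, IsSingleEar G H P ∧ (∀ w, w ∈ P.support ↔ τ.SameCycle u w) ∧
        ∀ w ∈ P.support, μ w ∈ P.support := by
  set z : ℤ → V := fun k => (τ ^ k) u with hz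
  have hτz : ∀ k, τ (z k) = z (k + 1) := fun k => by
    rw [hz, add_comm]
    simp only [zpow_add, zpow_one, Equiv.Perm.mul_apply]
  have z0 : z 0 = u := rfl
  have hμz : ∀ k, μ (z k) = z (-k) := by
    intro k
    let M : Equiv.Perm V := Function.Involutive.toPerm μ hμμ
    have hM : ∀ w, M w = μ w := fun _ => rfl
    have hs : SemiconjBy M τ τ⁻¹ := by
      rw [SemiconjBy, eq_inv_mul_iff_mul_eq]
      ext w
      simp only [Equiv.Perm.mul_apply, hM, hτ, hμμ, hνν]
    have := congrArg (· u) (hs.zpow_right k).eq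
    simp only [Equiv.Perm.mul_apply, hM, hμH u hu, inv_zpow'] at this
    exact this
  have hνz : ∀ k, ν (z k) = z (1 - k) := by
    intro k
    have := hτz (-k)
    rw [hτ, ← hμz, hμμ] at this
    rw [this]
    ring_nf
  set p := MulAction.period τ u with hp
  have hp0 : 0 < p := MulAction.period_pos_of_orderOf_pos (orderOf_pos τ) u
  have hzz : ∀ a b, z a = z b ↔ (p : ℤ) ∣ a - b := by
    intro a b
    rw [hp, ← MulAction.zpow_smul_eq_iff_period_dvd, sub_eq_neg_add, zpow_add, zpow_neg, mul_smul,
      inv_smul_eq_iff]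
    rfl
  obtain ⟨n, hn⟩ : ∃ n : ℕ, p = 2 * n := by
    rcases Nat.even_or_odd' p with ⟨n, h | h⟩
    · exact ⟨n, h⟩
    · have := hν (z (n + 1))
      rw [hνz, (hzz (1 - (n + 1)) (n + 1)).2 ⟨-1, by rw [h]; push_cast; ring⟩] at this
      exact (G.loopless.irrefl _ this).elim
  have hn0 : 0 < n := by omega
  have hmem : ∀ k, z k ∈ H.verts ↔ (n : ℤ) ∣ k := by
    intro k
    have e : (n : ℤ) ∣ k ↔ z (-k) = z k := by
      rw [hzz, hn]
      push_cast
      rw [show -k - k = 2 * -k by ring, mul_dvd_mul_iff_left two_ne_zero, dvd_neg]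
    rw [e, ← hμz]
    exact ⟨hμH _, fun h => by_contra fun h' => (hμ _ h').ne h.symm⟩
  have hcyc : ∀ w, τ.SameCycle u w ↔ ∃ k : ℤ, -n < k ∧ k ≤ n ∧ z k = w := by
    intro w
    constructor
    · rintro ⟨i, rfl⟩
      obtain ⟨k, hk, hk', -⟩ : ∃ k, (∃ c, i - k = 2 * n * c) ∧ (-n < k ∧ k ≤ (n : ℤ)) ∧ True := by
        have h1 := Int.emod_nonneg (i + (n - 1)) (b := 2 * n) (by omega)
        have h2 := Int.emod_lt_of_pos (i + (n - 1)) (b := 2 * (n : ℤ)) (by omega)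
        have h3 := Int.emod_add_mul_ediv (i + (n - 1)) (2 * n)
        refine ⟨(i + (n - 1)) % (2 * n) - (n - 1), ⟨(i + (n - 1)) / (2 * n), ?_⟩, ?_, trivial⟩
        · linarith
        · omega
      refine ⟨k, hk'.1, hk'.2, ?_⟩
      rw [eq_comm]
      change z i = z k
      rw [hzz, hn]
      obtain ⟨c, hc⟩ := hk
      exact ⟨c, by rw [hc]; push_cast; ring⟩
    · rintro ⟨k, -, -, rfl⟩
      exact ⟨k, rfl⟩
  have hinj : ∀ a b : ℤ, -n < a → a ≤ n → -n < b → b ≤ n → z a = z b → a = b := by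
    intro a b h1 h2 h3 h4 h
    rw [hzz, hn] at h
    have := Int.eq_zero_of_abs_lt_dvd h (by rw [abs_lt]; push_cast; constructor <;> omega)
    omega
  have hmem' : ∀ k : ℤ, -n < k → k ≤ n → z k ∈ H.verts → k = 0 ∨ k = n := by
    intro k h1 h2 h
    by_cases hk : k = n
    · exact Or.inr hk
    · exact Or.inl (Int.eq_zero_of_abs_lt_dvd ((hmem k).1 h)
        (by rw [abs_lt]; constructor <;> omega))
  have hνu : ν u = z 1 := by simpa [z0] using hνz 0
  have hH : ∀ w ∈ H.verts, τ.SameCycle u w → w = u ∨ w = z n := by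
    intro w hw hwu
    obtain ⟨k, h1, h2, rfl⟩ := (hcyc w).1 hwu
    rcases hmem' k h1 h2 hw with rfl | rfl
    · exact Or.inl rfl
    · exact Or.inr rfl
  have hne : z n ≠ u := fun h => by
    have := hinj n 0 (by omega) le_rfl (by omega) (by omega) h
    omega
  refine ⟨z n, (hmem _).2 dvd_rfl, ?_, hne, ⟨n, rfl⟩, hH, ?_⟩
  · intro h
    rw [hνz] at h
    have h1 := hH _ (H.edge_vert (H.symm.symm _ _ h)) ⟨_, rfl⟩
    rcases h1 with h1 | h1
    · rw [← hνz] at h1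
      have h2 : ν u = z n := by rw [← h1, hνν]
      rw [h2] at huν
      rw [← hνz, h1] at h
      exact huν (H.symm.symm _ _ h)
    · rw [h1] at h
      exact (H.adj_sub h).ne rfl
  · obtain ⟨P, hP, hodd, hsupp, hedge⟩ := exists_isPath_zigzag hinj hmem'
      (fun k => hνz k ▸ hν _) (fun k hk => hμz k ▸ hμ _ hk) (by rwa [z0, ← hνu]) (n - 1) (by omega)
    have hn1 : ((n - 1 : ℕ) : ℤ) + 1 = n := by omega
    have hend : z ((n - 1 : ℕ) + 1) = z n := by rw [hn1]
    have hs : ∀ w, w ∈ (P.copy z0 hend).support ↔ τ.SameCycle u w := by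
      intro w
      rw [Walk.support_copy, hsupp, hcyc]
      constructor <;>
      · rintro ⟨k, h1, h2, rfl⟩
        exact ⟨k, by omega, by omega, rfl⟩
    refine ⟨P.copy z0 hend, ⟨by rwa [Walk.isPath_copy], by rwa [Walk.length_copy], hu,
      (hmem _).2 dvd_rfl, ?_, by rwa [Walk.edges_copy]⟩, hs, ?_⟩
    · intro w hw h1 h2 hwH
      rcases hH w hwH ((hs w).1 hw) with h | h
      · exact h1 h
      · exact h2 h
    · intro w hw
      obtain ⟨k, rfl⟩ := (hs w).1 hw
      exact (hs _).2 (hμz k ▸ ⟨-k, rfl⟩)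

end Ears

section Steps

variable {V : Type*} {G : SimpleGraph V}

theorem IsSingleEar.verts_inter {H : G.Subgraph} {u v : V} {P : G.Walk u v}
    (hP : IsSingleEar G H P) : P.toSubgraph.verts ∩ H.verts = {u, v} := by
  obtain ⟨-, -, hu, hv, h, -⟩ := hP
  ext w
  simp only [Walk.verts_toSubgraph, Set.mem_inter_iff, Set.mem_ofPred_eq, Set.mem_insert_iff,
    Set.mem_singleton_iff]
  constructor
  · rintro ⟨hw, hwH⟩
    by_contra! hne
    exact h w hw hne.1 hne.2 hwH
  · rintro (rfl | rfl)
    · exact ⟨P.start_mem_support, hu⟩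
    · exact ⟨P.end_mem_support, hv⟩

theorem IsSingleEar.not_le {H : G.Subgraph} {u v : V} {P : G.Walk u v}
    (hP : IsSingleEar G H P) : ¬ P.toSubgraph ≤ H := by
  obtain ⟨-, hodd, -, -, -, he⟩ := hP
  intro hle
  cases P with
  | nil => simp at hodd
  | @cons _ w _ h q =>
    exact he s(u, w) (by simp) (hle.2 (by simp : (Walk.cons h q).toSubgraph.Adj u w))

theorem IsSingleEar.exists_matchesOn_interior {H : G.Subgraph} {u v : V} {P : G.Walk u v}
    (hP : IsSingleEar G H P) : ∃ m, MatchesOn G (P.toSubgraph.verts \ H.verts) m := by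
  obtain ⟨-, m, -, hm, -⟩ := hP.1.isEarLike hP.2.1
  refine ⟨m, ?_⟩
  rw [← hP.verts_inter, Set.sdiff_self_inter] at hm
  exact hm.mono P.toSubgraph.spanningCoe_le

theorem EarStep.exists_matchesOn_sdiff {H H' : G.Subgraph} (h : EarStep G H H') :
    ∃ m, MatchesOn G (H'.verts \ H.verts) m := by
  rcases h with ⟨u, v, P, hP, rfl⟩ | ⟨u, v, a, b, P₁, P₂, h₁, h₂, hd, rfl⟩
  · obtain ⟨m, hm⟩ := hP.exists_matchesOn_interior
    refine ⟨m, ?_⟩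
    rwa [Subgraph.verts_sup, Set.union_sdiff_left]
  · obtain ⟨m₁, hm₁⟩ := h₁.exists_matchesOn_interior
    obtain ⟨m₂, hm₂⟩ := h₂.exists_matchesOn_interior
    obtain ⟨m, hm, -⟩ := hm₁.exists_union hm₂ (by
      rw [Set.disjoint_left]
      rintro w ⟨hw, -⟩ ⟨hw', -⟩
      exact hd w ((Walk.mem_verts_toSubgraph _).1 hw) ((Walk.mem_verts_toSubgraph _).1 hw'))
    refine ⟨m, ?_⟩
    convert hm using 1
    ext w
    simp only [Subgraph.verts_sup, Set.mem_sdiff, Set.mem_union]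
    tauto

theorem EarStep.verts_subset {H H' : G.Subgraph} (h : EarStep G H H') : H.verts ⊆ H'.verts := by
  rcases h with ⟨u, v, P, hP, rfl⟩ | ⟨u, v, a, b, P₁, P₂, h₁, h₂, hd, rfl⟩
  · exact Set.subset_union_left
  · exact Set.subset_union_left.trans Set.subset_union_left

theorem MatchesOn.sdiff {S T : Set V} {m : V → V} (h : MatchesOn G S m)
    (hm : ∀ w ∈ T, m w ∈ T) : MatchesOn G (S \ T) m := by
  rintro w ⟨hw, hwT⟩
  obtain ⟨h1, h2, h3⟩ := h w hw
  exact ⟨⟨h1, fun h' => hwT (h3 ▸ hm _ h')⟩, h2, h3⟩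

/-- A conformal matching covered proper subgraph can be enlarged by a single or a double ear. -/
theorem exists_earStep [Finite V] (hG : MatchingCovered G) {H : G.Subgraph}
    (hH : MatchingCovered H.coe) (hconf : ∃ m, MatchesOn G H.vertsᶜ m) (htop : H ≠ ⊤) :
    ∃ H', EarStep G H H' ∧ H < H' ∧ MatchingCovered H'.coe ∧ ∃ m, MatchesOn G H'.vertsᶜ m := by
  classical
  have hH' := hH
  rw [matchingCovered_coe_iff] at hH'
  obtain ⟨hconn, hnon, hcov⟩ := hH'
  have hPM := hcov.exists_matchesOn hconn hnon
  obtain ⟨μ₀, hμ₀⟩ := hconf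
  -- an edge of `G` at `H` that is not in `H`, and a perfect matching through it
  obtain ⟨x, y, hxy, hx, hxyH⟩ : ∃ x y, G.Adj x y ∧ x ∈ H.verts ∧ ¬ H.Adj x y := by
    by_cases hv : H.verts = Set.univ
    · by_contra! hcon
      refine htop (Subgraph.ext hv ?_)
      ext a b
      exact ⟨H.adj_sub, fun h => hcon a b h (hv ▸ trivial)⟩
    · obtain ⟨a, ha, -⟩ := hnon
      obtain ⟨b, hb⟩ := (Set.ne_univ_iff_exists_notMem _).1 hv
      obtain ⟨x, y, hxy, hx, hy⟩ := hG.1.exists_adj_mem_notMem ha hb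
      exact ⟨x, y, hxy, hx, fun h => hy (H.edge_vert h.symm)⟩
  obtain ⟨ν, hν, hνx⟩ := hG.exists_matchesOn hxy
  let μ : V → V := fun w => if w ∈ H.verts then w else μ₀ w
  have hμH : ∀ w ∈ H.verts, μ w = w := fun w hw => if_pos hw
  have hμO : ∀ w ∉ H.verts, μ w = μ₀ w := fun w hw => if_neg hw
  have hμμ : ∀ w, μ (μ w) = w := by
    intro w
    by_cases hw : w ∈ H.verts
    · rw [hμH w hw, hμH w hw]
    · obtain ⟨h1, -, h3⟩ := hμ₀ w hw
      rw [hμO w hw, hμO _ h1, h3]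
  have hνν : ∀ w, ν (ν w) = w := fun w => (hν w trivial).2.2
  let τ : Equiv.Perm V :=
    Function.Involutive.toPerm μ hμμ |>.trans (Function.Involutive.toPerm ν hνν)
  have hτ : ∀ w, τ w = ν (μ w) := fun _ => rfl
  have hear := fun u (hu : u ∈ H.verts) (huν : ¬ H.Adj u (ν u)) => exists_ear (H := H) (τ := τ) hμH
    (fun w hw => by rw [hμO w hw]; exact (hμ₀ w hw).2.1) hμμ (fun w => (hν w trivial).2.1) hνν hτ
    hu huν
  choose! σ hσH hσν hσne hσc hσO P hP hPs using hear
  have hσσ : ∀ u, u ∈ H.verts → ¬ H.Adj u (ν u) → σ (σ u) = u := by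
    intro u hu huν
    exact (hσO u hu huν _ (hσH _ (hσH u hu huν) (hσν u hu huν))
      ((hσc u hu huν).trans (hσc _ (hσH u hu huν) (hσν u hu huν)))).resolve_right
        (hσne _ (hσH u hu huν) (hσν u hu huν))
  -- any suitable `R` gives the conclusion
  have hfin : ∀ R : G.Subgraph, EarStep G H (H ⊔ R) → ¬ R ≤ H → (H ⊔ R).Connected →
      IsEarLike R (R.verts ∩ H.verts) →
      (∃ m, MatchesOn H.spanningCoe (H.verts \ (R.verts ∩ H.verts)) m) →
      (∀ w ∈ R.verts, μ w ∈ R.verts) →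
      ∃ H', EarStep G H H' ∧ H < H' ∧ MatchingCovered H'.coe ∧
        ∃ m, MatchesOn G H'.vertsᶜ m := by
    intro R hstep hR hcon hel hm hμR
    refine ⟨H ⊔ R, hstep, left_lt_sup.2 hR, matchingCovered_coe_iff.2
      ⟨hcon, hnon.mono Set.subset_union_left, hcov.sup hPM hel rfl hm⟩, μ₀, ?_⟩
    convert hμ₀.sdiff (T := R.verts \ H.verts) ?_ using 1
    · ext w
      simp only [Subgraph.verts_sup, Set.mem_compl_iff, Set.mem_union, Set.mem_sdiff]
      tauto
    · rintro w ⟨hw, hwH⟩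
      exact ⟨hμO w hwH ▸ hμR w hw, (hμ₀ w hwH).1⟩
  have hlift : ∀ E : Set H.verts, (∃ m, MatchesOn H.coe Eᶜ m) →
      ∃ m, MatchesOn H.spanningCoe (H.verts \ Subtype.val '' E) m := by
    rintro E ⟨m, hm⟩
    obtain ⟨m', hm', -⟩ := hm.of_coe
    refine ⟨m', ?_⟩
    convert hm' using 1
    ext w
    simp
  have hPcon : ∀ (K : G.Subgraph) {u v : V} (Q : G.Walk u v), K.Connected → u ∈ K.verts →
      (K ⊔ Q.toSubgraph).Connected := fun K u v Q hK hu =>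
    Subgraph.connected_sup hK.preconnected Q.toSubgraph_connected.preconnected
      ⟨u, hu, (Walk.mem_verts_toSubgraph _).2 Q.start_mem_support⟩
  have hPμ : ∀ u (hu : u ∈ H.verts) (huν : ¬ H.Adj u (ν u)), ∀ w ∈ (P u hu huν).toSubgraph.verts,
      μ w ∈ (P u hu huν).toSubgraph.verts := by
    intro u hu huν w hw
    rw [Walk.mem_verts_toSubgraph] at hw ⊢
    exact (hPs u hu huν).2 w hw
  have := Fintype.ofFinite H.verts
  let σ' : H.verts → H.verts := fun a => if h : σ a.1 ∈ H.verts then ⟨σ a.1, h⟩ else a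
  have hσ' : ∀ a : H.verts, ¬ H.Adj a.1 (ν a.1) → (σ' a).1 = σ a.1 := by
    intro a ha
    simp only [σ', dif_pos (hσH a.1 a.2 ha)]
  have hνc : MatchesOn H.spanningCoe {w | H.Adj w (ν w)} ν := by
    intro w hw
    refine ⟨?_, hw, hνν w⟩
    rw [Set.mem_ofPred_eq, hνν]
    exact H.symm.symm _ _ hw
  obtain ⟨ν', hν', -⟩ := hνc.to_coe
  rcases exists_matchesOn_compl_pairs hconn.coe (fun a b hab => hH.exists_matchesOn hab)
    (U := {a : H.verts | ¬ H.Adj a.1 (ν a.1)}) ⟨⟨x, hx⟩, by rwa [Set.mem_ofPred_eq, hνx]⟩ (σ := σ')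
    (by
      intro a ha
      have h1 : ¬ H.Adj (σ' a).1 (ν (σ' a).1) := by
        rw [hσ' a ha]
        exact hσν a.1 a.2 ha
      refine ⟨h1, fun h => hσne a.1 a.2 ha ?_, Subtype.ext ?_⟩
      · rw [← hσ' a ha, h]
      · rw [hσ' _ h1, hσ' a ha]
        exact hσσ a.1 a.2 ha)
    (n := ν') (by convert hν' using 1; ext a; simp) with
    ⟨u, hu, hm⟩ | ⟨u, hu, u', hu', hne, hneσ, hm⟩
  · have hE := (hP u u.2 hu).verts_inter
    refine hfin _ (Or.inl ⟨_, _, P u u.2 hu, hP u u.2 hu, rfl⟩) (hP u u.2 hu).not_le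
      (hPcon H _ hconn u.2) ?_ ?_ (hPμ u u.2 hu)
    · rw [hE]
      exact (hP u u.2 hu).1.isEarLike (hP u u.2 hu).2.1
    · rw [hE]
      simpa only [Set.image_pair, hσ' u hu] using hlift _ hm
  · have hE := (hP u u.2 hu).verts_inter
    have hE' := (hP u' u'.2 hu').verts_inter
    have hd : ∀ w ∈ (P u u.2 hu).support, w ∉ (P u' u'.2 hu').support := by
      intro w hw hw'
      rw [(hPs u u.2 hu).1] at hw
      rw [(hPs u' u'.2 hu').1] at hw'
      rcases hσO u u.2 hu u' u'.2 (hw.trans hw'.symm) with h | h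
      · exact hne (Subtype.ext h)
      · exact hneσ (Subtype.ext (h.trans (hσ' u hu).symm))
    have hEE : ((P u u.2 hu).toSubgraph ⊔ (P u' u'.2 hu').toSubgraph).verts ∩ H.verts =
        {u.1, σ u.1} ∪ {u'.1, σ u'.1} := by
      rw [Subgraph.verts_sup, Set.union_inter_distrib_right, hE, hE']
    refine hfin ((P u u.2 hu).toSubgraph ⊔ (P u' u'.2 hu').toSubgraph)
      (Or.inr ⟨_, _, _, _, P u u.2 hu, P u' u'.2 hu', hP u u.2 hu, hP u' u'.2 hu', hd, (sup_assoc _ _ _).symm⟩)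
      (fun h => (hP u u.2 hu).not_le (le_sup_left.trans h)) ?_ ?_ ?_ ?_
    · rw [← sup_assoc]
      exact hPcon _ _ (hPcon H _ hconn u.2) (Or.inl u'.2)
    · rw [hEE]
      refine IsEarLike.sup ((hP u u.2 hu).1.isEarLike (hP u u.2 hu).2.1)
        ((hP u' u'.2 hu').1.isEarLike (hP u' u'.2 hu').2.1) ?_ ?_ ?_
      · rw [Set.disjoint_left]
        intro w hw hw'
        rw [Walk.mem_verts_toSubgraph] at hw hw'
        exact hd w hw hw'
      · rw [← hE]
        exact Set.inter_subset_left
      · rw [← hE']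
        exact Set.inter_subset_left
    · rw [hEE, Set.insert_union, Set.singleton_union]
      simpa only [Set.image_insert_eq, Set.image_singleton, hσ' u hu, hσ' u' hu'] using hlift _ hm
    · rintro w (hw | hw)
      · exact Or.inl (hPμ u u.2 hu w hw)
      · exact Or.inr (hPμ u' u'.2 hu' w hw)

theorem exists_earSteps [Finite V] (hG : MatchingCovered G) (H : G.Subgraph)
    (hH : MatchingCovered H.coe) (hconf : ∃ m, MatchesOn G H.vertsᶜ m) :
    ∃ (r : ℕ) (Gs : Fin (r + 1) → G.Subgraph), Gs 0 = H ∧ Gs (Fin.last r) = ⊤ ∧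
      (∀ i, MatchingCovered (Gs i).coe) ∧ ∀ i : Fin r, EarStep G (Gs i.castSucc) (Gs i.succ) := by
  induction H using WellFoundedGT.induction with
  | ind H ih =>
    by_cases htop : H = ⊤
    · exact ⟨0, fun _ => H, rfl, htop, fun _ => hH, fun i => i.elim0⟩
    · obtain ⟨H', hstep, hlt, hH', hconf'⟩ := exists_earStep hG hH hconf htop
      obtain ⟨r, Gs, h0, hr, hmc, hs⟩ := ih H' hlt hH' hconf'
      refine ⟨r + 1, Fin.cons H Gs, rfl, ?_, ?_, ?_⟩
      · rw [← Fin.succ_last, Fin.cons_succ]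
        exact hr
      · intro i
        refine Fin.cases ?_ (fun i => ?_) i
        · exact hH
        · exact hmc i
      · intro i
        refine Fin.cases ?_ (fun i => ?_) i
        · change EarStep G H (Gs 0)
          rwa [h0]
        · exact hs i

theorem exists_matchesOn_compl_of_earSteps {r : ℕ} {Gs : Fin (r + 1) → G.Subgraph}
    (hr : Gs (Fin.last r) = ⊤) (hs : ∀ i : Fin r, EarStep G (Gs i.castSucc) (Gs i.succ))
    (i : Fin (r + 1)) : ∃ m, MatchesOn G (Gs i).vertsᶜ m := by
  induction i using Fin.reverseInduction with
  | last =>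
    rw [hr, Subgraph.verts_top, Set.compl_univ]
    exact ⟨id, matchesOn_empty _⟩
  | cast i ih =>
    obtain ⟨m, hm⟩ := ih
    obtain ⟨m', hm'⟩ := (hs i).exists_matchesOn_sdiff
    have hsub := (hs i).verts_subset
    obtain ⟨n, hn, -⟩ := hm.exists_union hm' (Set.disjoint_left.2 fun w hw hw' => hw hw'.1)
    refine ⟨n, ?_⟩
    convert hn using 1
    ext w
    have := @hsub w
    simp only [Set.mem_compl_iff, Set.mem_union, Set.mem_sdiff]
    tauto

theorem conformalCycle_iff {u : V} {C : G.Walk u u} :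
    ConformalCycle G C ↔ ∃ m, MatchesOn G C.toSubgraph.vertsᶜ m := by
  have hv : C.toSubgraph.vertsᶜ = {w | w ∉ C.support} := by
    ext w
    simp
  rw [hv]
  constructor
  · rintro ⟨M, hM, hMv⟩
    obtain ⟨m, hm, -⟩ := hM.exists_matchesOn
    exact ⟨m, hMv ▸ hm⟩
  · rintro ⟨m, hm⟩
    obtain ⟨M, hM, hMv, -⟩ := hm.exists_isMatching
    exact ⟨M, hM, hMv⟩

end Steps

/-- A matching covered graph `G` is cycle-extendable if and only if
every even cycle of `G` extends to an ear decomposition of `G`. -/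
theorem cycleExtendable_iff_every_even_cycle_extends_to_ear_decomposition
    [Fintype V] (G : SimpleGraph V) (hG : MatchingCovered G) :
    CycleExtendable G ↔
      ∀ (v : V) (C : G.Walk v v), C.IsCycle → Even C.length →
        ∃ (r : ℕ) (Gs : Fin (r + 1) → G.Subgraph),
          IsEarDecomposition G r Gs ∧ Gs 0 = C.toSubgraph := by
  constructor
  · intro h v C hC heven
    obtain ⟨r, Gs, h0, hr, hmc, hs⟩ := exists_earSteps hG C.toSubgraph (hC.matchingCovered heven)
      (conformalCycle_iff.1 (h C hC heven))
    exact ⟨r, Gs, ⟨⟨v, C, hC, heven, h0⟩, hr, hmc, hs⟩, h0⟩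
  · intro h v C hC heven
    obtain ⟨r, Gs, ⟨-, hr, -, hs⟩, h0⟩ := h v C hC heven
    exact conformalCycle_iff.2 (h0 ▸ exists_matchesOn_compl_of_earSteps hr hs 0)
end

section
/- The only simple planar braces that are cycle-extendable are K_2 and the 4-cycle C_4. -/
open SimpleGraph

variable {V : Type*}

/-- `X` determines a tight cut of `G`: `X` is a nonempty proper set of vertices and
every perfect matching of `G` has exactly one edge with one end in `X` and one end
outside `X`. -/
def IsTightCut (G : SimpleGraph V) (X : Set V) : Prop :=
  X.Nonempty ∧ X ≠ Set.univ ∧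
    ∀ M : G.Subgraph, M.IsPerfectMatching →
      ∃! p : V × V, p.1 ∈ X ∧ p.2 ∉ X ∧ M.Adj p.1 p.2

/-- `G` has a nontrivial tight cut: a tight cut both of whose shores have
at least two vertices. -/
def HasNontrivialTightCut (G : SimpleGraph V) : Prop :=
  ∃ X : Set V, IsTightCut G X ∧ 2 ≤ X.ncard ∧ 2 ≤ Xᶜ.ncard

/-- A brick: a nonbipartite matching covered graph with no nontrivial tight cut. -/
def IsBrick (G : SimpleGraph V) : Prop :=
  MatchingCovered G ∧ ¬ G.Colorable 2 ∧ ¬ HasNontrivialTightCut G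

/-- A brace: a bipartite matching covered graph with no nontrivial tight cut. -/
def IsBrace (G : SimpleGraph V) : Prop :=
  MatchingCovered G ∧ G.Colorable 2 ∧ ¬ HasNontrivialTightCut G
/-- `G` contains a subgraph which is a subdivision of `K` in which the path replacing
each edge has length satisfying `okLen`: there are internally disjoint paths in `G`
joining the images of the branch vertices. -/
def HasSubdiv {W : Type*} (G : SimpleGraph V) (K : SimpleGraph W) (okLen : ℕ → Prop) : Prop :=
  ∃ (f : W ↪ V) (p : ∀ a b : W, K.Adj a b → G.Walk (f a) (f b)),
    (∀ a b hab, (p a b hab).IsPath) ∧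
    (∀ a b hab, okLen (p a b hab).length) ∧
    (∀ a b hab (c : W), f c ∈ (p a b hab).support → c = a ∨ c = b) ∧
    (∀ a b hab a' b' hab', s(a, b) ≠ s(a', b') →
      ∀ w, w ∈ (p a b hab).support → w ∈ (p a' b' hab').support →
        (w = f a ∨ w = f b) ∧ (w = f a' ∨ w = f b'))

/-- `G` is `K`-based: some subgraph of `G` is a bisubdivision of `K` (each edge of `K`
is replaced by an odd path, i.e. subdivided by an even number of vertices). -/
def IsBasedOn {W : Type*} (G : SimpleGraph V) (K : SimpleGraph W) : Prop :=
  HasSubdiv G K Odd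

/-- `G` contains a subdivision of `K`. -/
def ContainsSubdivision {W : Type*} (G : SimpleGraph V) (K : SimpleGraph W) : Prop :=
  HasSubdiv G K fun _ => True

/-- Planarity, via Kuratowski's characterization: no subdivision of `K₅` nor of `K₃,₃`. -/
def IsPlanar (G : SimpleGraph V) : Prop :=
  ¬ ContainsSubdivision G (⊤ : SimpleGraph (Fin 5)) ∧
  ¬ ContainsSubdivision G (completeBipartiteGraph (Fin 3) (Fin 3))

/-- `G` is `K₂,₃`-based: it contains a subgraph that is a bisubdivision of `K₂,₃`. -/
def K23Based (G : SimpleGraph V) : Prop :=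
  IsBasedOn G (completeBipartiteGraph (Fin 2) (Fin 3))

namespace SimpleGraph

namespace Walk

variable {G : SimpleGraph V}

/-- A path splits at each of its vertices into two paths meeting only there. -/
lemma IsPath.exists_split {u v w : V} {p : G.Walk u v} (hp : p.IsPath) (hw : w ∈ p.support) :
    ∃ (q : G.Walk u w) (r : G.Walk w v), q.IsPath ∧ r.IsPath ∧
      (∀ x, x ∈ p.support ↔ x ∈ q.support ∨ x ∈ r.support) ∧
      ∀ x, x ∈ q.support → x ∈ r.support → x = w := by
  obtain ⟨q, r, hq, hr, rfl⟩ := hp.mem_support_iff_exists_append.mp hw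
  refine ⟨q, r, hq, hr, fun x => mem_support_append_iff .., fun x hxq hxr => ?_⟩
  have hnd := hp.support_nodup
  rw [support_append] at hnd
  by_contra hne
  exact List.disjoint_of_nodup_append hnd hxq ((r.mem_support_iff.mp hxr).resolve_left hne)

/-- Two paths meeting only at their common end concatenate to a path. -/
lemma IsPath.append_of_inter {u v w : V} {q : G.Walk u w} {r : G.Walk w v} (hq : q.IsPath)
    (hr : r.IsPath) (h : ∀ x, x ∈ q.support → x ∈ r.support → x = w) :
    (q.append r).IsPath := by
  rw [isPath_def, support_append]
  refine hq.support_nodup.append hr.support_nodup.tail fun x hxq hxr => ?_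
  obtain rfl := h x hxq (List.mem_of_mem_tail hxr)
  have := hr.support_nodup
  rw [← cons_tail_support] at this
  exact (List.nodup_cons.mp this).1 hxr

/-- Two distinct vertices of a cycle split it into two paths meeting only at these vertices. -/
lemma IsCycle.exists_split {u p q : V} {C : G.Walk u u} (hC : C.IsCycle) (hp : p ∈ C.support)
    (hq : q ∈ C.support) (hpq : p ≠ q) :
    ∃ P Q : G.Walk p q, P.IsPath ∧ Q.IsPath ∧
      (∀ x, x ∈ C.support ↔ x ∈ P.support ∨ x ∈ Q.support) ∧
      ∀ x, x ∈ P.support → x ∈ Q.support → x = p ∨ x = q := by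
  classical
  have hmem (x : V) : x ∈ (C.rotate p hp).support ↔ x ∈ C.support := mem_support_rotate_iff ..
  have hD := hC.rotate hp
  generalize C.rotate p hp = D at hmem hD
  have hqD := (hmem q).mpr hq
  obtain ⟨P, R, hPR⟩ := mem_support_iff_exists_append.mp hqD
  subst hPR
  have hP := hD.isPath_of_append_left (not_nil_of_ne hpq.symm)
  have hR := hD.isPath_of_append_right (not_nil_of_ne hpq)
  refine ⟨P, R.reverse, hP, hR.reverse, fun x => ?_, fun x hxP hxR => ?_⟩
  · rw [← hmem, mem_support_append_iff, support_reverse, List.mem_reverse]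
  · have hnd := hD.support_nodup
    rw [tail_support_append] at hnd
    rw [support_reverse, List.mem_reverse] at hxR
    by_contra! hne
    exact List.disjoint_of_nodup_append hnd ((P.mem_support_iff.mp hxP).resolve_left hne.1)
      ((R.mem_support_iff.mp hxR).resolve_left hne.2)

/-- Two paths with the same ends, meeting only at these ends, one of which has an internal vertex,
form a cycle. -/
lemma IsPath.exists_isCycle {p q c : V} {P Q : G.Walk p q} (hP : P.IsPath) (hQ : Q.IsPath)
    (hc : c ∈ P.support) (hcp : c ≠ p) (hcq : c ≠ q)
    (h : ∀ x, x ∈ P.support → x ∈ Q.support → x = p ∨ x = q) :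
    ∃ C : G.Walk p p, C.IsCycle ∧ ∀ x, x ∈ C.support ↔ x ∈ P.support ∨ x ∈ Q.support := by
  refine ⟨P.append Q.reverse, hP.isCycle_append hQ.reverse (fun x hxP hxQ => ?_) (.inl ?_),
    fun x => by simp⟩
  · have hnP := hP.support_nodup
    have hnQ := hQ.reverse.support_nodup
    rw [← cons_tail_support] at hnP hnQ
    have h1 : x ≠ p := by rintro rfl; exact (List.nodup_cons.mp hnP).1 hxP
    have h2 : x ≠ q := by rintro rfl; exact (List.nodup_cons.mp hnQ).1 hxQ
    have := h x (List.mem_of_mem_tail hxP) (by simpa using List.mem_of_mem_tail hxQ)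
    tauto
  · cases P with
    | nil => simp at hc; exact absurd hc hcp
    | cons h P =>
      cases P with
      | nil => simp at hc; tauto
      | cons h P => simp

/-- A walk ending in `S` contains a path with the same start that meets `S` only at its end. -/
lemma exists_isPath_first_hit {u t : V} (p : G.Walk u t) (S : Set V) (ht : t ∈ S) :
    ∃ (z : V) (q : G.Walk u z), q.IsPath ∧ z ∈ S ∧ (∀ x ∈ q.support, x ∈ p.support) ∧
      ∀ x ∈ q.support, x ∈ S → x = z := by
  classical
  suffices ∃ (z : V) (q : G.Walk u z), z ∈ S ∧ (∀ x ∈ q.support, x ∈ p.support) ∧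
      ∀ x ∈ q.support, x ∈ S → x = z by
    obtain ⟨z, q, hz, hqp, hq⟩ := this
    exact ⟨z, q.bypass, q.bypass_isPath, hz, fun x hx => hqp x (q.support_bypass_subset_support hx),
      fun x hx => hq x (q.support_bypass_subset_support hx)⟩
  induction p with
  | nil => exact ⟨_, nil, ht, fun _ => id, by simp⟩
  | @cons a b c h p ih =>
    by_cases ha : a ∈ S
    · exact ⟨a, nil, ha, by simp, by simp⟩
    · obtain ⟨z, q, hz, hqp, hq⟩ := ih ht
      refine ⟨z, cons h q, hz, fun x hx => ?_, fun x hx hxS => ?_⟩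
      · rw [support_cons, List.mem_cons] at hx ⊢
        exact hx.imp_right (hqp x)
      · rw [support_cons, List.mem_cons] at hx
        exact hq x (hx.resolve_left fun e => ha (e ▸ hxS)) hxS

end Walk

open Walk

variable {G : SimpleGraph V}

/-- The vertices other than `v` remain joined to each other after the deletion of `v` and any
further vertex `x`. -/
def LinkedAvoiding (G : SimpleGraph V) (v : V) : Prop :=
  ∀ x a b : V, a ≠ v → a ≠ x → b ≠ v → b ≠ x → ∃ p : G.Walk a b, v ∉ p.support ∧ x ∉ p.support

lemma LinkedAvoiding.exists_path_through_of_walk {v : V} (hG : G.LinkedAvoiding v) {S : Set V}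
    (hvS : v ∉ S) (hS : S.Nontrivial) {c s : V} (R : G.Walk c s) (hs : s ∈ S) (hvR : v ∉ R.support)
    (hcS : c ∉ S) :
    ∃ (p q : V) (E : G.Walk p q), E.IsPath ∧ p ∈ S ∧ q ∈ S ∧ p ≠ q ∧ c ∈ E.support ∧
      v ∉ E.support ∧ ∀ x ∈ E.support, x ∈ S → x = p ∨ x = q := by
  induction R with
  | nil => exact absurd hs hcS
  | @cons c d s h R ih =>
    rw [support_cons, List.mem_cons, not_or] at hvR
    have hvd : d ≠ v := fun e => hvR.2 (e ▸ R.start_mem_support)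
    by_cases hdS : d ∈ S
    · obtain ⟨t, htS, htd⟩ := hS.exists_ne d
      obtain ⟨W, hvW, hdW⟩ := hG d c t (Ne.symm hvR.1) h.ne (fun e => hvS (e ▸ htS)) htd
      obtain ⟨z, T, hT, hzS, hTW, hTS⟩ := W.exists_isPath_first_hit S htS
      refine ⟨d, z, cons h.symm T, hT.cons fun hd => hdW (hTW d hd), hdS, hzS,
        fun e => hdW (hTW d (e ▸ T.end_mem_support)), ?_, ?_, ?_⟩
      · simp
      · simp only [support_cons, List.mem_cons, not_or]
        exact ⟨hvd.symm, fun hv => hvW (hTW v hv)⟩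
      · simp only [support_cons, List.mem_cons]
        rintro x (rfl | hx) hxS
        · exact .inl rfl
        · exact .inr (hTS x hx hxS)
    · obtain ⟨p, q, E, hE, hpS, hqS, hpq, hdE, hvE, hES⟩ := ih hs hvR.2 hdS
      by_cases hcE : c ∈ E.support
      · exact ⟨p, q, E, hE, hpS, hqS, hpq, hcE, hvE, hES⟩
      have hpd : p ≠ d := fun e => hdS (e ▸ hpS)
      have hqd : q ≠ d := fun e => hdS (e ▸ hqS)
      obtain ⟨W, hvW, hdW⟩ := hG d c p (Ne.symm hvR.1) h.ne (fun e => hvS (e ▸ hpS)) hpd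
      obtain ⟨z, T, hT, hz, hTW, hTS⟩ := W.exists_isPath_first_hit (S ∪ {x | x ∈ E.support})
        (.inl hpS)
      have hvT : v ∉ T.support := fun hv => hvW (hTW v hv)
      have hdT : d ∉ T.support := fun hd => hdW (hTW d hd)
      have hzd : z ≠ d := fun e => hdT (e ▸ T.end_mem_support)
      -- `key` joins the pieces of the path `p' ⟶ z ⟵ c ⟶ d ⟶ q'`
      have key : ∀ {p' q' : V} (F : G.Walk p' z) (D : G.Walk d q'), F.IsPath → D.IsPath →
          p' ∈ S → q' ∈ S → c ∉ F.support → v ∉ F.support → c ∉ D.support → v ∉ D.support →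
          (∀ x ∈ F.support, x ∈ T.support → x = z) → (∀ x ∈ D.support, x ∉ T.support) →
          (∀ x ∈ F.support, x ∉ D.support) → (∀ x ∈ F.support, x ∈ S → x = p') →
          (∀ x ∈ D.support, x ∈ S → x = q') →
          ∃ (p q : V) (E : G.Walk p q), E.IsPath ∧ p ∈ S ∧ q ∈ S ∧ p ≠ q ∧ c ∈ E.support ∧
            v ∉ E.support ∧ ∀ x ∈ E.support, x ∈ S → x = p ∨ x = q := by
        intro p' q' F D hF hD hp' hq' hcF hvF hcD hvD hFT hDT hFD hFS hDS
        have hX : (F.append T.reverse).IsPath :=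
          hF.append_of_inter hT.reverse (by simpa using hFT)
        have hY : (cons h D).IsPath := hD.cons hcD
        refine ⟨p', q', (F.append T.reverse).append (cons h D), hX.append_of_inter hY ?_, hp', hq',
          ?_, ?_, ?_, ?_⟩
        · simp only [mem_support_append_iff, support_reverse, List.mem_reverse, support_cons,
            List.mem_cons]
          grind
        · rintro rfl
          exact hFD _ F.start_mem_support D.end_mem_support
        · simp
        · simp only [mem_support_append_iff, support_reverse, List.mem_reverse, support_cons,
            List.mem_cons]
          grind
        · have hTS' (x) (hx : x ∈ T.support) (hxS : x ∈ S) : x = z := hTS x hx (.inl hxS)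
          have hzF := F.end_mem_support
          simp only [mem_support_append_iff, support_reverse, List.mem_reverse, support_cons,
            List.mem_cons]
          grind
      have hTE (x) (hxE : x ∈ E.support) (hxT : x ∈ T.support) : x = z := hTS x hxT (.inr hxE)
      obtain ⟨X, Y, hX, hY, hEXY, hXY⟩ := hE.exists_split hdE
      have hqX : q ∉ X.support := fun hq => hqd (hXY q hq Y.end_mem_support)
      have hpY : p ∉ Y.support := fun hp => hpd (hXY p X.start_mem_support hp)
      have hXS (x) (hx : x ∈ X.support) (hxS : x ∈ S) : x = p :=
        (hES x ((hEXY x).2 (.inl hx)) hxS).resolve_right fun e => hqX (e ▸ hx)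
      have hYS (x) (hx : x ∈ Y.support) (hxS : x ∈ S) : x = q :=
        (hES x ((hEXY x).2 (.inr hx)) hxS).resolve_left fun e => hpY (e ▸ hx)
      by_cases hzE : z ∈ E.support
      · rcases (hEXY z).1 hzE with hzX | hzY
        · obtain ⟨F, F', hF, -, hXF, hFF⟩ := hX.exists_split hzX
          have hdF : d ∉ F.support := fun hd => hzd (hFF d hd F'.end_mem_support).symm
          exact key F Y hF hY hpS hqS (by grind) (by grind) (by grind) (by grind) (by grind)
            (by grind) (by grind) (by grind) (by grind)
        · obtain ⟨F', F, -, hF, hYF, hFF⟩ := hY.exists_split hzY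
          have hdF : d ∉ F.support := fun hd => hzd (hFF d F'.start_mem_support hd).symm
          refine key F.reverse X.reverse hF.reverse hX.reverse hqS hpS ?_ ?_ ?_ ?_ ?_ ?_ ?_ ?_ ?_ <;>
            simp only [support_reverse, List.mem_reverse] <;> grind
      · have hzS : z ∈ S := hz.resolve_right hzE
        refine key (nil : G.Walk z z) Y .nil hY hzS hqS ?_ ?_ ?_ ?_ ?_ ?_ ?_ ?_ ?_ <;>
          grind [support_nil, end_mem_support]

/-- The fan lemma for two paths: a vertex outside `S` lies on a path with distinct ends in `S`
and no further vertex in `S`. -/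
lemma LinkedAvoiding.exists_path_through {v : V} (hG : G.LinkedAvoiding v) {S : Set V}
    (hvS : v ∉ S) (hS : S.Nontrivial) {c : V} (hcv : c ≠ v) (hcS : c ∉ S) :
    ∃ (p q : V) (E : G.Walk p q), E.IsPath ∧ p ∈ S ∧ q ∈ S ∧ p ≠ q ∧ c ∈ E.support ∧
      v ∉ E.support ∧ ∀ x ∈ E.support, x ∈ S → x = p ∨ x = q := by
  obtain ⟨s, hs⟩ := hS.nonempty
  have hsv : s ≠ v := fun e => hvS (e ▸ hs)
  obtain ⟨R, hvR, -⟩ := hG v c s hcv hcv hsv hsv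
  exact hG.exists_path_through_of_walk hvS hS R hs hvR hcS

/-- A subdivision of `K₃,₃` given by its two triples of branch vertices and nine paths. -/
lemma containsSubdivision_K33 {f g : Fin 3 → V} (hf : f.Injective) (hg : g.Injective)
    (hfg : ∀ i j, f i ≠ g j) (P : ∀ i j, G.Walk (f i) (g j)) (hP : ∀ i j, (P i j).IsPath)
    (hPf : ∀ i j k, f k ∈ (P i j).support → k = i) (hPg : ∀ i j k, g k ∈ (P i j).support → k = j)
    (hdisj : ∀ i j i' j', (i, j) ≠ (i', j') → ∀ x, x ∈ (P i j).support → x ∈ (P i' j').support →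
      (x = f i ∨ x = g j) ∧ (x = f i' ∨ x = g j')) :
    ContainsSubdivision G (completeBipartiteGraph (Fin 3) (Fin 3)) := by
  refine ⟨⟨Sum.elim f g, hf.sumElim hg hfg⟩, fun a b hab => match a, b, hab with
    | .inl i, .inr j, _ => P i j
    | .inr j, .inl i, _ => (P i j).reverse
    | .inl _, .inl _, h => absurd h (by simp)
    | .inr _, .inr _, h => absurd h (by simp), ?_, fun _ _ _ => trivial, ?_, ?_⟩
  · rintro (i | i) (j | j) hab
    · simp at hab
    · exact hP i j
    · exact (hP j i).reverse
    · simp at hab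
  · rintro (i | i) (j | j) hab (k | k) h
    all_goals simp at hab
    all_goals simp at h ⊢
    · exact hPf _ _ _ h
    · exact hPg _ _ _ h
    · exact hPf _ _ _ h
    · exact hPg _ _ _ h
  · rintro (i | i) (j | j) hab (i' | i') (j' | j') hab' hne x h h'
    all_goals simp at hab hab'
    all_goals simp at h h' hne ⊢
    · exact hdisj i j i' j' (by simpa using hne) x h h'
    · have := hdisj i j j' i' (by simp; tauto) x h h'
      tauto
    · have := hdisj j i i' j' (by simp; tauto) x h h'
      tauto
    · have := hdisj j i j' i' (by simp; tauto) x h h'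
      tauto

/-- Three paths with common ends, each with an internal neighbour of a further vertex `v`, yield a
subdivision of `K₃,₃`. -/
lemma containsSubdivision_K33_of_theta {v p q : V} (hpq : p ≠ q) (P : Fin 3 → G.Walk p q)
    (hP : ∀ i, (P i).IsPath) (hv : ∀ i, v ∉ (P i).support)
    (hdisj : ∀ i j, i ≠ j → ∀ x, x ∈ (P i).support → x ∈ (P j).support → x = p ∨ x = q)
    (g : Fin 3 → V) (hgP : ∀ i, g i ∈ (P i).support) (hgp : ∀ i, g i ≠ p) (hgq : ∀ i, g i ≠ q)
    (hvg : ∀ i, G.Adj v (g i)) :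
    ContainsSubdivision G (completeBipartiteGraph (Fin 3) (Fin 3)) := by
  choose X Y hX hY hXY hXY' using fun i => (hP i).exists_split (hgP i)
  have hvp : v ≠ p := fun e => hv 0 (e ▸ (P 0).start_mem_support)
  have hvq : v ≠ q := fun e => hv 0 (e ▸ (P 0).end_mem_support)
  have hvg' (i) : v ≠ g i := (hvg i).ne
  have hpY (i) : p ∉ (Y i).support := fun h => hgp i (hXY' i p (X i).start_mem_support h).symm
  have hqX (i) : q ∉ (X i).support := fun h => hgq i (hXY' i q h (Y i).end_mem_support).symm
  have hg (i j) (h : g i ∈ (P j).support) : i = j := by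
    by_contra hij
    have := hdisj i j hij _ (hgP i) h
    grind
  let f : Fin 3 → V := ![p, q, v]
  let W : ∀ i j, G.Walk (f i) (g j) := fun i j => match i with
    | 0 => X j
    | 1 => (Y j).reverse
    | 2 => (hvg j).toWalk
  have hW0 (j x) : x ∈ (W 0 j).support ↔ x ∈ (X j).support := .rfl
  have hW1 (j x) : x ∈ (W 1 j).support ↔ x ∈ (Y j).support := by
    change x ∈ (Y j).reverse.support ↔ _
    rw [support_reverse, List.mem_reverse]
  have hW2 (j x) : x ∈ (W 2 j).support ↔ x = v ∨ x = g j := by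
    change x ∈ (cons (hvg j) nil).support ↔ _
    rw [support_cons, support_nil, List.mem_cons, List.mem_singleton]
  have hf0 : f 0 = p := rfl
  have hf1 : f 1 = q := rfl
  have hf2 : f 2 = v := rfl
  refine containsSubdivision_K33 (f := f) (g := g) ?_ ?_ ?_ W ?_ ?_ ?_ ?_
  · intro i j h
    fin_cases i <;> fin_cases j <;> simp [f] at h ⊢ <;> grind
  · intro i j h
    exact hg i j (h ▸ hgP j)
  · intro i j
    fin_cases i <;> simp [f] <;> grind
  · intro i j
    fin_cases i
    · exact hX j
    · exact (hY j).reverse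
    · exact (hvg j).isPath_toWalk
  · intro i j k h
    fin_cases i <;> fin_cases k <;> simp [hW0, hW1, hW2, hf0, hf1, hf2] at h ⊢ <;> grind
  · intro i j k h
    fin_cases i <;> simp [hW0, hW1, hW2] at h <;> grind
  · intro i j i' j' hne x h h'
    fin_cases i <;> fin_cases i' <;> simp [hW0, hW1, hW2, hf0, hf1, hf2] at h h' hne ⊢ <;>
      grind [start_mem_support, end_mem_support]

/-- A cycle avoiding `v` and missing a neighbour of `v` can be replaced by one covering more
neighbours of `v`, unless there is a subdivision of `K₃,₃`. -/
lemma LinkedAvoiding.exists_cycle_covering_more {v c : V} (hG : G.LinkedAvoiding v)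
    (hK : ¬ ContainsSubdivision G (completeBipartiteGraph (Fin 3) (Fin 3)))
    {u : V} {C : G.Walk u u} (hC : C.IsCycle) (hvC : v ∉ C.support)
    (hvc : G.Adj v c) (hcC : c ∉ C.support) :
    ∃ (u' : V) (D : G.Walk u' u'), D.IsCycle ∧ v ∉ D.support ∧
      {w | G.Adj v w ∧ w ∉ D.support} ⊂ {w | G.Adj v w ∧ w ∉ C.support} := by
  have hS : {x | x ∈ C.support}.Nontrivial :=
    ⟨u, C.start_mem_support, C.snd, C.getVert_mem_support 1, (C.adj_snd hC.not_nil).ne⟩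
  obtain ⟨p, q, E, hE, hp, hq, hpq, hcE, hvE, hES⟩ :=
    hG.exists_path_through (S := {x | x ∈ C.support}) hvC hS hvc.ne' hcC
  rw [Set.mem_ofPred] at hp hq
  obtain ⟨P, Q, hP, hQ, hCPQ, hPQ⟩ := hC.exists_split hp hq hpq
  have hcp : c ≠ p := fun e => hcC (e ▸ hp)
  have hcq : c ≠ q := fun e => hcC (e ▸ hq)
  have hvP : v ∉ P.support := fun h => hvC ((hCPQ v).2 (.inl h))
  have hvQ : v ∉ Q.support := fun h => hvC ((hCPQ v).2 (.inr h))
  have hEP (x) (h : x ∈ E.support) (h' : x ∈ P.support) : x = p ∨ x = q :=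
    hES x h ((hCPQ x).2 (.inl h'))
  have hEQ (x) (h : x ∈ E.support) (h' : x ∈ Q.support) : x = p ∨ x = q :=
    hES x h ((hCPQ x).2 (.inr h'))
  have hpE := E.start_mem_support
  have hqE := E.end_mem_support
  by_cases hb : ∃ b, G.Adj v b ∧ b ∈ Q.support ∧ b ≠ p ∧ b ≠ q
  · by_cases ha : ∃ a, G.Adj v a ∧ a ∈ P.support ∧ a ≠ p ∧ a ≠ q
    · obtain ⟨a, hva, haP, hap, haq⟩ := ha
      obtain ⟨b, hvb, hbQ, hbp, hbq⟩ := hb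
      refine absurd (containsSubdivision_K33_of_theta (v := v) hpq ![E, P, Q] ?_ ?_ ?_ ![c, a, b]
        ?_ ?_ ?_ ?_) hK
      · simp [Fin.forall_fin_succ, hE, hP, hQ]
      · simp [Fin.forall_fin_succ, hvE, hvP, hvQ]
      · intro i j hij x hi hj
        fin_cases i <;> fin_cases j <;> simp at hij hi hj <;> grind
      · simp [Fin.forall_fin_succ, hcE, haP, hbQ]
      · simp [Fin.forall_fin_succ, hcp, hap, hbp]
      · simp [Fin.forall_fin_succ, hcq, haq, hbq]
      · simp [Fin.forall_fin_succ, hvc, hva, hvb]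
    · obtain ⟨D, hD, hDEQ⟩ := hE.exists_isCycle hQ hcE hcp hcq hEQ
      refine ⟨p, D, hD, by simp [hDEQ, hvE, hvQ], fun w ⟨hvw, hw⟩ => ⟨hvw, ?_⟩, fun h => ?_⟩
      · grind
      · exact (h ⟨hvc, hcC⟩).2 ((hDEQ c).2 (.inl hcE))
  · obtain ⟨D, hD, hDEP⟩ := hE.exists_isCycle hP hcE hcp hcq hEP
    refine ⟨p, D, hD, by simp [hDEP, hvE, hvP], fun w ⟨hvw, hw⟩ => ⟨hvw, ?_⟩, fun h => ?_⟩
    · grind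
    · exact (h ⟨hvc, hcC⟩).2 ((hDEP c).2 (.inl hcE))

/-- In the absence of a subdivision of `K₃,₃`, some cycle avoids `v` and contains all neighbours
of `v`. -/
lemma LinkedAvoiding.exists_cycle_covering [Finite V] {v : V} (hG : G.LinkedAvoiding v)
    (hK : ¬ ContainsSubdivision G (completeBipartiteGraph (Fin 3) (Fin 3)))
    {u : V} (C : G.Walk u u) (hC : C.IsCycle) (hvC : v ∉ C.support) :
    ∃ (u' : V) (D : G.Walk u' u'), D.IsCycle ∧ v ∉ D.support ∧ ∀ w, G.Adj v w → w ∈ D.support := by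
  induction h : {w | G.Adj v w ∧ w ∉ C.support}.ncard using Nat.strong_induction_on
    generalizing u with
  | _ n ih =>
    by_cases hc : ∃ c, G.Adj v c ∧ c ∉ C.support
    · obtain ⟨c, hvc, hcC⟩ := hc
      obtain ⟨u', D, hD, hvD, hlt⟩ := hG.exists_cycle_covering_more hK hC hvC hvc hcC
      exact ih _ (h ▸ Set.ncard_lt_ncard hlt) D hD hvD rfl
    · push Not at hc
      exact ⟨u, C, hC, hvC, hc⟩

lemma LinkedAvoiding.exists_cycle [Fintype V] {v : V} (hG : G.LinkedAvoiding v)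
    (hcard : 4 ≤ Fintype.card V) : ∃ (u : V) (C : G.Walk u u), C.IsCycle ∧ v ∉ C.support := by
  classical
  have step (s : Finset V) (hs : s.card < 4) : ∃ z, z ∉ s := by
    by_contra! h
    have := Finset.card_le_card (fun z _ => h z : Finset.univ ⊆ s)
    rw [Finset.card_univ] at this
    lia
  have nbr (b x : V) (hbv : b ≠ v) (hbx : b ≠ x) : ∃ d, G.Adj b d ∧ d ≠ v ∧ d ≠ x := by
    obtain ⟨z, hz⟩ := step {b, v, x} (Finset.card_le_three.trans_lt (by norm_num))
    simp only [Finset.mem_insert, Finset.mem_singleton, not_or] at hz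
    obtain ⟨p, hv, hx⟩ := hG x b z hbv hbx hz.2.1 hz.2.2
    cases p with
    | nil => exact absurd rfl hz.1
    | @cons _ d _ h p =>
      simp only [support_cons, List.mem_cons, not_or] at hv hx
      exact ⟨d, h, fun e => hv.2 (e ▸ p.start_mem_support),
        fun e => hx.2 (e ▸ p.start_mem_support)⟩
  obtain ⟨b, hb⟩ := step {v} (by simp)
  rw [Finset.mem_singleton] at hb
  obtain ⟨d, hbd, hdv, -⟩ := nbr b v hb hb
  obtain ⟨e, hbe, hev, hed⟩ := nbr b d hb hbd.ne
  obtain ⟨p, hvp, hbp⟩ := hG b d e hdv hbd.ne' hev hbe.ne'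
  have hmem {x} (hx : x ∈ p.bypass.support) := p.support_bypass_subset_support hx
  obtain ⟨C, hC, hCx⟩ := IsPath.exists_isCycle (P := cons hbd p.bypass) (Q := hbe.toWalk) (c := d)
    (p.bypass_isPath.cons fun h => hbp (hmem h)) hbe.isPath_toWalk (by simp) hbd.ne' hed.symm
    (fun x _ hx => by
      change x ∈ (cons hbe nil).support at hx
      simpa using hx)
  refine ⟨b, C, hC, fun h => ?_⟩
  rcases (hCx v).1 h with h | h
  · rw [support_cons, List.mem_cons] at h
    exact h.elim (fun e => hb e.symm) fun h => hvp (hmem h)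
  · change v ∈ (cons hbe nil).support at h
    simp at h
    grind

/-- A cycle avoiding a vertex but containing all its neighbours is not conformal. -/
lemma not_conformalCycle {u v : V} {C : G.Walk u u} (hv : v ∉ C.support)
    (hC : ∀ w, G.Adj v w → w ∈ C.support) : ¬ ConformalCycle G C := by
  rintro ⟨M, hM, hMC⟩
  have hvM : v ∈ M.verts := by rw [hMC]; exact hv
  obtain ⟨w, hw, -⟩ := hM hvM
  have hwM := M.edge_vert hw.symm
  rw [hMC] at hwM
  exact hwM (hC w hw.adj_sub)

section Bipartite

variable {A X : Set V}

/-- `A` and its complement are the colour classes of a bipartition of `G`. -/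
def IsColorClass (G : SimpleGraph V) (A : Set V) : Prop :=
  ∀ ⦃a b⦄, G.Adj a b → (a ∈ A ↔ b ∉ A)

lemma IsColorClass.compl (hA : G.IsColorClass A) : G.IsColorClass Aᶜ := fun a b h => by
  have := hA h
  simp only [Set.mem_compl_iff]
  tauto

lemma Colorable.exists_isColorClass (h : G.Colorable 2) : ∃ A, G.IsColorClass A := by
  obtain ⟨c⟩ := h
  refine ⟨{x | c x = 0}, fun a b hab => ?_⟩
  have := c.valid hab
  simp only [Set.mem_ofPred]
  lia

lemma Subgraph.IsPerfectMatching.exists_partner {M : G.Subgraph} (hM : M.IsPerfectMatching) :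
    ∃ m : V → V, m.Involutive ∧ ∀ a b, M.Adj a b ↔ b = m a := by
  rw [Subgraph.isPerfectMatching_iff] at hM
  choose m hm hm' using hM
  exact ⟨m, fun a => (hm' _ _ (hm a).symm).symm, fun a b => ⟨hm' a b, fun e => e ▸ hm a⟩⟩

lemma MatchingCovered.exists_isPerfectMatching (hG : MatchingCovered G) :
    ∃ M : G.Subgraph, M.IsPerfectMatching := by
  obtain ⟨hconn, hnt, he⟩ := hG
  obtain ⟨a⟩ := hconn.nonempty
  obtain ⟨b, hab⟩ := hconn.preconnected.exists_adj_of_nontrivial a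
  obtain ⟨M, hM, -⟩ := he s(a, b) hab
  exact ⟨M, hM⟩

/-- If no edge joins `X ∩ A` to the complement of `X`, then `X ∩ A` is not larger than `X \ A`. -/
lemma IsColorClass.ncard_inter_le [Finite V] (hA : G.IsColorClass A) (hG : MatchingCovered G)
    (hX : ∀ a ∈ X, a ∈ A → ∀ b, G.Adj a b → b ∈ X) : (X ∩ A).ncard ≤ (X \ A).ncard := by
  obtain ⟨M, hM⟩ := hG.exists_isPerfectMatching
  obtain ⟨m, hm, hMm⟩ := hM.exists_partner
  have hadj (a) : G.Adj a (m a) := ((hMm a _).2 rfl).adj_sub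
  exact Set.ncard_le_ncard_of_injOn m
    (fun a ha => ⟨hX a ha.1 ha.2 _ (hadj a), (hA (hadj a)).1 ha.2⟩)
    hm.injective.injOn

lemma IsColorClass.ncard_inter_lt [Finite V] (hA : G.IsColorClass A) (hG : MatchingCovered G)
    (hX : ∀ a ∈ X, a ∈ A → ∀ b, G.Adj a b → b ∈ X) (hne : X.Nonempty) (huniv : X ≠ Set.univ) :
    (X ∩ A).ncard < (X \ A).ncard := by
  by_contra! hle
  refine huniv (Set.eq_univ_of_forall fun z => ?_)
  obtain ⟨x, hx⟩ := hne
  obtain ⟨p⟩ := hG.1.preconnected x z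
  induction p with
  | nil => exact hx
  | @cons a b _ hab p ih =>
    refine ih ?_
    by_contra hb
    have haA : a ∉ A := fun ha => hb (hX a hx ha b hab)
    obtain ⟨M, hM, hMab⟩ := hG.2.2 s(a, b) hab
    obtain ⟨m, hm, hMm⟩ := hM.exists_partner
    have hadj (a) : G.Adj a (m a) := ((hMm a _).2 rfl).adj_sub
    have hmb : m a = b := ((hMm a b).1 hMab).symm
    have h1 : (X ∩ A).ncard ≤ ((X \ A) \ {a}).ncard :=
      Set.ncard_le_ncard_of_injOn m (fun c hc => ⟨⟨hX c hc.1 hc.2 _ (hadj c),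
        (hA (hadj c)).1 hc.2⟩, fun e => hb (by
          rw [← hmb, ← Set.mem_singleton_iff.1 e, hm c]; exact hc.1)⟩) hm.injective.injOn
    have h2 := Set.ncard_sdiff_singleton_lt_of_mem (show a ∈ X \ A from ⟨hx, haA⟩)
    lia

lemma IsColorClass.isTightCut [Finite V] (hA : G.IsColorClass A)
    (hX : ∀ a ∈ X, a ∈ A → ∀ b, G.Adj a b → b ∈ X) (huniv : X ≠ Set.univ)
    (hcard : (X \ A).ncard = (X ∩ A).ncard + 1) : IsTightCut G X := by
  refine ⟨?_, huniv, fun M hM => ?_⟩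
  · by_contra! h
    simp [h] at hcard
  obtain ⟨m, hm, hMm⟩ := hM.exists_partner
  have hadj (a) : G.Adj a (m a) := ((hMm a _).2 rfl).adj_sub
  have hsub : m '' (X ∩ A) ⊆ X \ A := by
    rintro _ ⟨a, ha, rfl⟩
    exact ⟨hX a ha.1 ha.2 _ (hadj a), (hA (hadj a)).1 ha.2⟩
  have hone : ((X \ A) \ m '' (X ∩ A)).ncard = 1 := by
    rw [Set.ncard_sdiff hsub, Set.ncard_image_of_injective _ hm.injective]
    lia
  obtain ⟨a, ha⟩ := Set.ncard_eq_one.1 hone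
  have ha' : a ∈ (X \ A) \ m '' (X ∩ A) := ha ▸ rfl
  refine ⟨(a, m a), ⟨ha'.1.1, fun hmX => ha'.2 ⟨m a, ⟨hmX, ?_⟩, hm a⟩, (hMm a _).2 rfl⟩, ?_⟩
  · have := (hA (hadj a)).not.1 ha'.1.2
    tauto
  · rintro ⟨c, d⟩ ⟨hc, hd, hcd⟩
    simp only at hc hd hcd
    have hd' := (hMm c d).1 hcd
    have hcm : c ∈ (X \ A) \ m '' (X ∩ A) := by
      refine ⟨⟨hc, fun hcA => hd (hX c hc hcA d hcd.adj_sub)⟩, ?_⟩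
      rintro ⟨e, he, rfl⟩
      rw [hm e] at hd'
      exact hd (hd' ▸ he.1)
    rw [ha, Set.mem_singleton_iff] at hcm
    subst hcm
    rw [hd']

lemma IsColorClass.ncard_inter_add_two_le [Finite V] (hA : G.IsColorClass A) (hG : IsBrace G)
    (hX : ∀ a ∈ X, a ∈ A → ∀ b, G.Adj a b → b ∈ X) (h2 : 2 ≤ X.ncard) (h2' : 2 ≤ Xᶜ.ncard) :
    (X ∩ A).ncard + 2 ≤ (X \ A).ncard := by
  have hne : X.Nonempty := Set.nonempty_of_ncard_ne_zero (by lia)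
  have huniv : X ≠ Set.univ := by
    rintro rfl
    simp at h2'
  have := hA.ncard_inter_lt hG.1 hX hne huniv
  by_contra! hlt
  exact hG.2.2 ⟨X, hA.isTightCut hX huniv (by lia), h2, h2'⟩

lemma IsColorClass.ncard_compl [Finite V] (hA : G.IsColorClass A) (hG : MatchingCovered G) :
    A.ncard = Aᶜ.ncard := by
  have h1 := hA.ncard_inter_le hG (X := Set.univ) (by simp)
  have h2 := hA.compl.ncard_inter_le hG (X := Set.univ) (by simp)
  simp only [Set.univ_inter, ← Set.compl_eq_univ_sdiff, compl_compl] at h1 h2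
  exact le_antisymm h1 h2

/-- A separation of a brace by at most two vertices exists only in graphs with at most four
vertices. -/
lemma IsColorClass.card_le_four_of_separation [Fintype V] (hA : G.IsColorClass A) (hG : IsBrace G)
    {W L : Set V} {x y : V} (hW : W.Nonempty) (hL : L.Nonempty) (hWL : Disjoint W L)
    (hxW : x ∉ W) (hxL : x ∉ L) (hyW : y ∉ W) (hyL : y ∉ L)
    (hcover : ∀ z, z ∈ W ∨ z ∈ L ∨ z = x ∨ z = y)
    (hedge : ∀ a ∈ W, ∀ b ∈ L, ¬ G.Adj a b) (hxA : x ∈ A) : Fintype.card V ≤ 4 := by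
  have hWx (a) (ha : a ∈ W) (b) (hab : G.Adj a b) : b ∈ W ∨ b = x ∨ b = y := by
    have := hcover b
    have := fun h => hedge a ha b h hab
    tauto
  have hLx (a) (ha : a ∈ L) (b) (hab : G.Adj a b) : b ∈ L ∨ b = x ∨ b = y := by
    have := hcover b
    have := fun h => hedge b h a ha hab.symm
    tauto
  have hWn := Set.ncard_inter_add_ncard_sdiff_eq_ncard W A
  have hLn := Set.ncard_inter_add_ncard_sdiff_eq_ncard L A
  have hW1 : 1 ≤ W.ncard := hW.ncard_pos
  have hL1 : 1 ≤ L.ncard := hL.ncard_pos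
  have hxy2 : ({x, y} : Set V).ncard ≤ 2 := by
    simpa using Set.ncard_insert_le x {y}
  by_cases hyA : y ∈ A
  · have closed {X : Set V} (h : ∀ a ∈ X, ∀ b, G.Adj a b → b ∈ X ∨ b = x ∨ b = y) :
        ∀ a ∈ X, a ∈ A → ∀ b, G.Adj a b → b ∈ X := by
      intro a ha haA b hab
      have hb := (hA hab).1 haA
      rcases h a ha b hab with h | rfl | rfl <;> tauto
    have cW := hA.ncard_inter_lt hG.1 (closed hWx) hW (fun h => hxW (h ▸ trivial))
    have cL := hA.ncard_inter_lt hG.1 (closed hLx) hL (fun h => hxL (h ▸ trivial))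
    have hAeq := hA.ncard_compl hG.1
    have e1 : A.ncard ≤ (W ∩ A).ncard + (L ∩ A).ncard + ({x, y} : Set V).ncard := by
      calc A.ncard ≤ ((W ∩ A) ∪ (L ∩ A) ∪ {x, y}).ncard := Set.ncard_le_ncard fun z hz => by
            have := hcover z
            simp only [Set.mem_union, Set.mem_inter_iff, Set.mem_insert_iff, Set.mem_singleton_iff]
            tauto
        _ ≤ _ := (Set.ncard_union_le _ _).trans (Nat.add_le_add_right (Set.ncard_union_le _ _) _)
    have e2 : (W \ A).ncard + (L \ A).ncard ≤ Aᶜ.ncard := by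
      rw [← Set.ncard_union_eq (hWL.mono Set.sdiff_subset Set.sdiff_subset)]
      exact Set.ncard_le_ncard fun z hz => hz.elim And.right And.right
    have hV : Fintype.card V = A.ncard + Aᶜ.ncard := by
      rw [Set.ncard_add_ncard_compl, Nat.card_eq_fintype_card]
    have hxy : x ≠ y := by
      rintro rfl
      rw [Set.pair_eq_singleton, Set.ncard_singleton] at e1
      lia
    have htwo {X : Set V} (hxX : x ∉ X) (hyX : y ∉ X) : 2 ≤ Xᶜ.ncard := by
      rw [← Set.ncard_pair hxy]
      exact Set.ncard_le_ncard (by rintro z (rfl | rfl) <;> assumption)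
    have bW := fun h => hA.ncard_inter_add_two_le hG (closed hWx) h (htwo hxW hyW)
    have bL := fun h => hA.ncard_inter_add_two_le hG (closed hLx) h (htwo hxL hyL)
    have e3 : Aᶜ.ncard ≤ (W \ A).ncard + (L \ A).ncard := by
      refine (Set.ncard_le_ncard fun z hz => ?_).trans (Set.ncard_union_le _ _)
      have := hcover z
      simp only [Set.mem_union, Set.mem_sdiff, Set.mem_compl_iff] at hz ⊢
      grind
    lia
  · have hxy : x ≠ y := fun e => hyA (e ▸ hxA)
    obtain ⟨l, hl⟩ := hL
    obtain ⟨w, hw⟩ := hW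
    have hlW : l ∉ W := fun h => Set.disjoint_left.1 hWL h hl
    have two {s t : V} (hst : s ≠ t) {X : Set V} (hs : s ∈ X) (ht : t ∈ X) : 2 ≤ X.ncard := by
      rw [← Set.ncard_pair hst]
      exact Set.ncard_le_ncard (by rintro z (rfl | rfl) <;> assumption)
    have b1 := hA.ncard_inter_add_two_le hG (X := insert y W)
      (by
        rintro a (rfl | ha) haA b hab
        · exact absurd haA hyA
        · have := (hA hab).1 haA
          rcases hWx a ha b hab with h | rfl | rfl
          · exact .inr h
          · tauto
          · exact .inl rfl)
      (two (s := y) (t := w) (by grind) (.inl rfl) (.inr hw))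
      (two (s := x) (t := l) (by grind) (by simp [hxy, hxW]) (by simp [hlW]; grind))
    have b2 := hA.compl.ncard_inter_add_two_le hG (X := insert x W)
      (by
        rintro a (rfl | ha) haA b hab
        · exact absurd hxA haA
        · have := hA hab
          rcases hWx a ha b hab with h | rfl | rfl
          · exact .inr h
          · exact .inl rfl
          · simp at haA; tauto)
      (two (s := x) (t := w) (by grind) (.inl rfl) (.inr hw))
      (two (s := y) (t := l) (by grind) (by simp [hxy.symm, hyW]) (by simp [hlW]; grind))
    rw [Set.insert_inter_of_notMem hyA, Set.insert_sdiff_of_notMem _ hyA,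
      Set.ncard_insert_of_notMem (by simp [hyW])] at b1
    rw [← Set.sdiff_eq, Set.sdiff_compl, Set.insert_inter_of_mem hxA, Set.insert_sdiff_of_mem _ hxA,
      Set.ncard_insert_of_notMem (by simp [hxW])] at b2
    lia

lemma _root_.IsBrace.linkedAvoiding [Fintype V] (hG : IsBrace G) (hcard : 4 < Fintype.card V)
    (v : V) : G.LinkedAvoiding v := by
  intro x a b hav hax hbv hbx
  by_contra hno
  obtain ⟨A, hA⟩ := hG.2.1.exists_isColorClass
  let W : Set V := {z | ∃ p : G.Walk a z, v ∉ p.support ∧ x ∉ p.support}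
  have hvW : v ∉ W := fun ⟨p, h, _⟩ => h p.end_mem_support
  have hxW : x ∉ W := fun ⟨p, _, h⟩ => h p.end_mem_support
  have hW : W.Nonempty := ⟨a, nil, by simpa using hav.symm, by simpa using hax.symm⟩
  have key {A : Set V} (hA : G.IsColorClass A) : v ∉ A := by
    intro hvA
    refine hcard.not_ge (hA.card_le_four_of_separation hG (W := W)
      (L := {z | z ∉ W ∧ z ≠ v ∧ z ≠ x}) (x := v) (y := x) hW ⟨b, hno, hbv, hbx⟩
      (Set.disjoint_left.2 fun z hz hz' => hz'.1 hz) hvW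
      (by simp) hxW (by simp) (fun z => ?_) ?_ hvA)
    · simp only [Set.mem_ofPred]
      tauto
    · rintro c ⟨p, hvp, hxp⟩ d ⟨hd, hdv, hdx⟩ hcd
      refine hd ⟨p.concat hcd, ?_, ?_⟩ <;>
        simp only [support_concat, List.mem_append, List.mem_singleton] <;>
        grind
  exact key hA.compl (key hA)

/-- A bipartite matching covered graph on four vertices is complete bipartite. -/
lemma IsColorClass.adj_of_card_eq_four [Fintype V] (hA : G.IsColorClass A) (hG : MatchingCovered G)
    (hAc : A.ncard = 2) (hAc' : Aᶜ.ncard = 2) {a b : V} (ha : a ∈ A) (hb : b ∉ A) : G.Adj a b := by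
  have hN (c) (hc : G.Adj a c) : c ∉ A := (hA hc).1 ha
  have e1 : insert a (G.neighborSet a) ∩ A = {a} := by
    ext z
    have := hN z
    simp only [Set.mem_inter_iff, Set.mem_insert_iff, mem_neighborSet, Set.mem_singleton_iff]
    grind
  have e2 : insert a (G.neighborSet a) \ A = G.neighborSet a := by
    ext z
    have := hN z
    simp only [Set.mem_sdiff, Set.mem_insert_iff, mem_neighborSet]
    grind
  have h := hA.ncard_inter_lt hG (X := insert a (G.neighborSet a)) ?_ ⟨a, .inl rfl⟩ ?_
  · rw [e1, e2, Set.ncard_singleton] at h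
    have := Set.eq_of_subset_of_ncard_le (s := G.neighborSet a) (t := Aᶜ) hN (by lia)
    change b ∈ G.neighborSet a
    rw [this]
    exact hb
  · rintro c (rfl | hc) hcA d hcd
    · exact .inr hcd
    · exact absurd hcA (hN c hc)
  · intro h
    rw [h, Set.univ_inter] at e1
    simp [e1] at hAc

end Bipartite

lemma MatchingCovered.nonempty_iso_of_card_le_four [Fintype V] (hG : MatchingCovered G)
    (hcol : G.Colorable 2) (hcard : Fintype.card V ≤ 4) :
    Nonempty (G ≃g (⊤ : SimpleGraph (Fin 2))) ∨ Nonempty (G ≃g cycleGraph 4) := by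
  obtain ⟨A, hA⟩ := hcol.exists_isColorClass
  have hAc := hA.ncard_compl hG
  have hV : Fintype.card V = A.ncard + Aᶜ.ncard := by
    rw [Set.ncard_add_ncard_compl, Nat.card_eq_fintype_card]
  have := hG.2.1
  have h1 := Fintype.one_lt_card (α := V)
  have h12 : A.ncard = 1 ∨ A.ncard = 2 := by lia
  rcases h12 with h | h
  · left
    obtain ⟨a, ha⟩ := Set.ncard_eq_one.1 h
    obtain ⟨b, hb⟩ := Set.ncard_eq_one.1 (hAc ▸ h)
    have htop : G = ⊤ := by
      have hab (z) : z = a ∨ z = b := by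
        have : z ∈ A ∨ z ∈ Aᶜ := em _
        rwa [hb, ha] at this
      obtain ⟨c, hc⟩ := hG.1.preconnected.exists_adj_of_nontrivial a
      have hcb : c = b := (hab c).resolve_left hc.ne'
      subst hcb
      ext y z
      simp only [top_adj]
      refine ⟨Adj.ne, fun hne => ?_⟩
      rcases hab y with rfl | rfl <;> rcases hab z with rfl | rfl
      · exact absurd rfl hne
      · exact hc
      · exact hc.symm
      · exact absurd rfl hne
    subst htop
    exact ⟨Iso.completeGraph (Fintype.equivFinOfCardEq (by lia))⟩
  · right
    have h' : Aᶜ.ncard = 2 := hAc ▸ h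
    have hadj {a b : V} := hA.adj_of_card_eq_four hG h h' (a := a) (b := b)
    obtain ⟨a, a', haa, hAe⟩ := Set.ncard_eq_two.1 h
    obtain ⟨b, b', hbb, hBe⟩ := Set.ncard_eq_two.1 h'
    have ha : a ∈ A := by simp [hAe]
    have ha' : a' ∈ A := by simp [hAe]
    have hb : b ∉ A := show b ∈ Aᶜ by simp [hBe]
    have hb' : b' ∉ A := show b' ∈ Aᶜ by simp [hBe]
    have hcov (z) : z = a ∨ z = a' ∨ z = b ∨ z = b' := by
      have : z ∈ A ∨ z ∈ Aᶜ := em _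
      rw [hBe, hAe] at this
      simpa [or_assoc] using this
    have hbij : Function.Bijective ![a, b, a', b'] := by
      constructor
      · intro i j hij
        fin_cases i <;> fin_cases j <;> simp at hij ⊢ <;> grind
      · intro z
        rcases hcov z with rfl | rfl | rfl | rfl
        exacts [⟨0, rfl⟩, ⟨2, rfl⟩, ⟨1, rfl⟩, ⟨3, rfl⟩]
    have naa : ¬ G.Adj a a' := fun e => (hA e).1 ha ha'
    have nbb : ¬ G.Adj b b' := fun e => (hA.compl e).1 hb hb'
    have hab := hadj ha hb
    have hab' := hadj ha hb'
    have ha'b := hadj ha' hb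
    have ha'b' := hadj ha' hb'
    refine ⟨Iso.symm ⟨Equiv.ofBijective _ hbij, fun {i j} => ?_⟩⟩
    fin_cases i <;> fin_cases j <;>
      simp [cycleGraph_adj, G.adj_comm, naa, nbb, hab, hab', ha'b, ha'b'] <;> grind [adj_comm]

lemma cycleExtendable_of_card_le_four [Fintype V] (hcard : Fintype.card V ≤ 4) :
    CycleExtendable G := by
  classical
  intro u C hC heven
  refine ⟨⊥, by simp [Subgraph.IsMatching], ?_⟩
  have h3 := hC.three_le_length
  have h4 : 4 ≤ C.length := by
    obtain ⟨k, hk⟩ := heven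
    lia
  have hle : C.length ≤ C.support.toFinset.card := by
    calc C.length = C.support.tail.length := by simp
      _ = C.support.tail.toFinset.card := (List.toFinset_card_of_nodup hC.support_nodup).symm
      _ ≤ _ := Finset.card_le_card fun x hx => by
        simp only [List.mem_toFinset] at hx ⊢
        exact List.mem_of_mem_tail hx
  have huniv := Finset.eq_univ_of_card C.support.toFinset
    (le_antisymm (Finset.card_le_univ _) (by lia))
  ext w
  have : w ∈ C.support.toFinset := huniv ▸ Finset.mem_univ w
  simpa using this

end SimpleGraph

/-- The only simple planar cycle-extendable braces are `K₂` and the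
4-cycle `C₄`. -/
theorem brace_planar_cycleExtendable_iff [Fintype V] (G : SimpleGraph V)
    (hbrace : IsBrace G) (hplanar : IsPlanar G) :
    CycleExtendable G ↔
      (Nonempty (G ≃g (⊤ : SimpleGraph (Fin 2))) ∨ Nonempty (G ≃g cycleGraph 4)) := by
  refine ⟨fun hext => ?_, ?_⟩
  · refine hbrace.1.nonempty_iso_of_card_le_four hbrace.2.1 ?_
    by_contra! hcard
    obtain ⟨v⟩ := hbrace.1.1.nonempty
    have hlink := hbrace.linkedAvoiding hcard v
    obtain ⟨u, C, hC, hvC⟩ := hlink.exists_cycle hcard.le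
    obtain ⟨u', D, hD, hvD, hND⟩ := hlink.exists_cycle_covering hplanar.2 C hC hvC
    exact not_conformalCycle hvD hND
      (hext D hD (two_colorable_iff_forall_loop_even.1 hbrace.2.1 u' D))
  · rintro (⟨⟨e⟩⟩ | ⟨⟨e⟩⟩) <;> apply cycleExtendable_of_card_le_four <;>
      simp [Fintype.card_congr e.toEquiv]
end
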